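/- arXiv:1505.03136 — 4 statements merged into one kernel-verified Lean document; each statement's English description precedes it below -/
import Mathlib

section
/- Let f : Z → X and g : Z → Y be closed immersions of schemes. Then the pushout X ⊔_Z Y of f and g exists in the category of schemes. -/
open AlgebraicGeometry CategoryTheory CategoryTheory.Limits

universe u

open TopologicalSpace Opposite

lemma TopCat.exists_preimage_of_isPushout {Z X Y P : TopCat.{u}} {f : Z ⟶ X} {g : Z ⟶ Y}
    {i : X ⟶ P} {j : Y ⟶ P} (h : IsPushout f g i j) (p : P) :
    (∃ x, i x = p) ∨ ∃ y, j y = p := by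
  obtain ⟨_ | _ | _, x, hx⟩ := Concrete.isColimit_exists_rep _ h.isColimit p
  · exact .inl ⟨f x, by rw [← hx, h.cocone.condition_zero]; rfl⟩
  · exact .inl ⟨x, hx⟩
  · exact .inr ⟨x, hx⟩

lemma TopCat.exists_opens_of_isPushout {Z X Y P : TopCat.{u}} {f : Z ⟶ X} {g : Z ⟶ Y}
    {i : X ⟶ P} {j : Y ⟶ P} (h : IsPushout f g i j) (U : Opens X) (V : Opens Y)
    (e : (Opens.map f).obj U = (Opens.map g).obj V) :
    ∃ W : Opens P, (Opens.map i).obj W = U ∧ (Opens.map j).obj W = V := by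
  have cont {T : TopCat.{u}} (U : Opens T) : Continuous fun x ↦ ULift.up.{u} (x ∈ U) :=
    continuous_uliftUp.comp (continuous_Prop.2 U.2)
  let a : X ⟶ TopCat.of (ULift.{u} Prop) := TopCat.ofHom ⟨_, cont U⟩
  let b : Y ⟶ TopCat.of (ULift.{u} Prop) := TopCat.ofHom ⟨_, cont V⟩
  have hab : f ≫ a = g ≫ b := by
    ext z
    exact iff_of_eq (congr_arg (z ∈ ·) e)
  let c := h.desc a b hab
  refine ⟨⟨{p | (c p).down}, continuous_Prop.1 (continuous_uliftDown.comp c.hom.2)⟩, ?_, ?_⟩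
  · ext x
    exact iff_of_eq (congr_arg ULift.down (ConcreteCategory.congr_hom (h.inl_desc a b hab) x))
  · ext y
    exact iff_of_eq (congr_arg ULift.down (ConcreteCategory.congr_hom (h.inr_desc a b hab) y))

namespace AlgebraicGeometry.PresheafedSpace

variable {Z X Y P : PresheafedSpace.{_, _, u} CommRingCat.{u}} {f : Z ⟶ X} {g : Z ⟶ Y}
    {i : X ⟶ P} {j : Y ⟶ P}

lemma pushout_section_ext (W : Opens (pushout f g).carrier)
    (s t : (pushout f g).presheaf.obj (op W))
    (h₁ : (pushout.inl f g).c.app (op W) s = (pushout.inl f g).c.app (op W) t)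
    (h₂ : (pushout.inr f g).c.app (op W) s = (pushout.inr f g).c.app (op W) t) : s = t := by
  let e := colimitPresheafObjIsoComponentwiseLimit (span f g) W
  apply e.commRingCatIsoToRingEquiv.injective
  refine Concrete.limit_ext _ _ _ ?_
  have key (k) := ConcreteCategory.congr_hom
    (colimitPresheafObjIsoComponentwiseLimit_hom_π (span f g) W k)
  have hl := (key .left s).trans (h₁.trans (key .left t).symm)
  rintro ⟨_ | _ | _⟩
  · have hw := limit.w (componentwiseDiagram (span f g) W) WalkingSpan.Hom.fst.op
    exact (ConcreteCategory.congr_hom hw _).symm.trans ((congr_arg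
      ((componentwiseDiagram (span f g) W).map WalkingSpan.Hom.fst.op) hl).trans
      (ConcreteCategory.congr_hom hw _))
  · exact hl
  · exact (key .right s).trans (h₂.trans (key .right t).symm)

lemma pushout_exists_section (W : Opens (pushout f g).carrier)
    (a : X.presheaf.obj (op ((Opens.map (pushout.inl f g).base).obj W)))
    (b : Y.presheaf.obj (op ((Opens.map (pushout.inr f g).base).obj W)))
    (T : Opens Z.carrier)
    (hf : T = (Opens.map f.base).obj ((Opens.map (pushout.inl f g).base).obj W))
    (hg : T = (Opens.map g.base).obj ((Opens.map (pushout.inr f g).base).obj W))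
    (hab : Z.presheaf.map (homOfLE hf.le).op (f.c.app _ a) =
      Z.presheaf.map (homOfLE hg.le).op (g.c.app _ b)) :
    ∃ s, (pushout.inl f g).c.app (op W) s = a ∧ (pushout.inr f g).c.app (op W) s = b := by
  let e := colimitPresheafObjIsoComponentwiseLimit (span f g) W
  let D := componentwiseDiagram (span f g) W
  have hT : T = (Opens.map (colimit.ι (span f g) .zero).base).obj W := by
    rw [hf, ← colimit.w (span f g) WalkingSpan.Hom.fst]
    rfl
  subst hT
  let x : (D ⋙ CategoryTheory.forget CommRingCat.{u}).sections :=
    ⟨fun k ↦ match k with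
      | op .zero => Z.presheaf.map (homOfLE hf.le).op (f.c.app _ a)
      | op .left => a
      | op .right => b, by
      rintro ⟨k⟩ ⟨k'⟩ ⟨φ⟩
      obtain _ | _ | _ := φ
      · exact ConcreteCategory.congr_hom (D.map_id _) _
      · rfl
      · exact hab.symm⟩
  let hD := isLimitOfPreserves (CategoryTheory.forget CommRingCat.{u}) (limit.isLimit D)
  let l := (Types.isLimitEquivSections hD).symm x
  have hl (k) : limit.π D k l = x.1 k := Types.isLimitEquivSections_symm_apply hD x k
  have key (k) : (colimit.ι (span f g) k).c.app (op W) (e.inv l) = x.1 (op k) :=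
    (ConcreteCategory.congr_hom (colimitPresheafObjIsoComponentwiseLimit_inv_ι_app
      (span f g) W k) l).trans (hl _)
  exact ⟨e.inv l, key .left, key .right⟩

lemma section_ext_of_isPushout (h : IsPushout f g i j) (W : Opens P.carrier)
    (s t : P.presheaf.obj (op W)) (h₁ : i.c.app (op W) s = i.c.app (op W) t)
    (h₂ : j.c.app (op W) s = j.c.app (op W) t) : s = t := by
  obtain ⟨e, rfl, rfl⟩ : ∃ e : pushout f g ≅ P, pushout.inl f g ≫ e.hom = i ∧
      pushout.inr f g ≫ e.hom = j :=
    ⟨h.isoPushout.symm, h.inl_isoPushout_inv, h.inr_isoPushout_inv⟩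
  have := PresheafedSpace.c_isIso_of_iso e.hom
  have : IsIso (e.hom.c.app (op W)) := inferInstance
  exact (asIso (e.hom.c.app (op W))).commRingCatIsoToRingEquiv.injective
    (pushout_section_ext _ _ _ h₁ h₂)

lemma exists_section_of_isPushout (h : IsPushout f g i j) (W : Opens P.carrier)
    (a : X.presheaf.obj (op ((Opens.map i.base).obj W)))
    (b : Y.presheaf.obj (op ((Opens.map j.base).obj W))) (T : Opens Z.carrier)
    (hf : T = (Opens.map f.base).obj ((Opens.map i.base).obj W))
    (hg : T = (Opens.map g.base).obj ((Opens.map j.base).obj W))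
    (hab : Z.presheaf.map (homOfLE hf.le).op (f.c.app _ a) =
      Z.presheaf.map (homOfLE hg.le).op (g.c.app _ b)) :
    ∃ s, i.c.app (op W) s = a ∧ j.c.app (op W) s = b := by
  obtain ⟨e, rfl, rfl⟩ : ∃ e : pushout f g ≅ P, pushout.inl f g ≫ e.hom = i ∧
      pushout.inr f g ≫ e.hom = j :=
    ⟨h.isoPushout.symm, h.inl_isoPushout_inv, h.inr_isoPushout_inv⟩
  have := PresheafedSpace.c_isIso_of_iso e.hom
  have : IsIso (e.hom.c.app (op W)) := inferInstance
  obtain ⟨s, hs, hs'⟩ := pushout_exists_section ((Opens.map e.hom.base).obj W) a b T hf hg hab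
  obtain ⟨s, rfl⟩ := (asIso (e.hom.c.app (op W))).commRingCatIsoToRingEquiv.surjective s
  exact ⟨s, hs, hs'⟩

end AlgebraicGeometry.PresheafedSpace

lemma IsLocalization.Away.bijective_of_comp_algebraMap {R L S : Type*} [CommRing R] [CommRing L]
    [CommRing S] {_ : Algebra R L} {r : R} (hr : IsLocalization.Away r L)
    (φ : L →+* S) (ρ : R →+* S)
    (h : φ.comp (algebraMap R L) = ρ) (hinj : ∀ s, ρ s = 0 → ∃ n : ℕ, r ^ n * s = 0)
    (hsurj : ∀ t, ∃ (n : ℕ) (s : R), ρ s = ρ r ^ n * t) : Function.Bijective φ := by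
  subst h
  have hu : IsUnit (algebraMap R L r) := hr.algebraMap_isUnit r
  constructor
  · rw [injective_iff_map_eq_zero]
    intro l hl
    obtain ⟨n, a, ha⟩ := IsLocalization.Away.surj r l
    obtain ⟨m, hm⟩ := hinj a (by simp [← ha, hl])
    have : algebraMap R L r ^ m * algebraMap R L a = 0 := by
      rw [← map_pow, ← map_mul, hm, map_zero]
    rwa [(hu.pow m).mul_right_eq_zero, ← ha, (hu.pow n).mul_left_eq_zero] at this
  · intro t
    obtain ⟨n, s, hs⟩ := hsurj t
    obtain ⟨v, hv⟩ := (hu.pow n).exists_left_inv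
    refine ⟨v * algebraMap R L s, ?_⟩
    have : φ v * (φ (algebraMap R L r)) ^ n = 1 := by rw [← map_pow, ← map_mul, hv, map_one]
    simp only [RingHom.comp_apply] at hs
    rw [map_mul, hs, ← mul_assoc, this, one_mul]

/-- Conditions on an open subset `W` of a locally ringed space, phrased in terms of its ring of
sections, which ensure that `W` is an affine scheme. -/
structure LooksAffine (P : LocallyRingedSpace.{u}) (W : Opens P.toTopCat) : Prop where
  exists_basicOpen : ∀ p ∈ W, ∀ W' : Opens P.toTopCat, p ∈ W' → ∃ r : P.presheaf.obj (op W),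
    p ∈ P.toRingedSpace.basicOpen r ∧ P.toRingedSpace.basicOpen r ≤ W'
  exists_of_prime : ∀ I : Ideal (P.presheaf.obj (op W)), I.IsPrime →
    ∃ p ∈ W, ∀ r, r ∈ I ↔ p ∉ P.toRingedSpace.basicOpen r
  exists_pow_mul_eq_zero : ∀ (r s : P.presheaf.obj (op W)),
    P.presheaf.map (homOfLE (P.toRingedSpace.basicOpen_le r)).op s = 0 → ∃ n : ℕ, r ^ n * s = 0
  exists_map_eq : ∀ (r : P.presheaf.obj (op W))
    (t : P.presheaf.obj (op (P.toRingedSpace.basicOpen r))),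
    ∃ (n : ℕ) (s : P.presheaf.obj (op W)),
      P.presheaf.map (homOfLE (P.toRingedSpace.basicOpen_le r)).op s =
        P.presheaf.map (homOfLE (P.toRingedSpace.basicOpen_le r)).op r ^ n * t

namespace LooksAffine

lemma isHomeomorph_toΓSpecFun {Q : LocallyRingedSpace.{u}} [T0Space Q.toTopCat]
    (hQ : LooksAffine Q ⊤) : IsHomeomorph (X := Q.toTopCat) Q.toΓSpecFun := by
  have hpre (r) : (Q.toΓSpecFun ⁻¹' (SetLike.coe (PrimeSpectrum.basicOpen r)) : Set Q.toTopCat) =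
    SetLike.coe (Q.toRingedSpace.basicOpen r) := Q.toΓSpec_preimage_basicOpen_eq r
  rw [isHomeomorph_iff_isEmbedding_surjective]
  constructor
  · refine Topology.IsInducing.isEmbedding ((Topology.isInducing_iff_nhds).2 fun x ↦ ?_)
    refine le_antisymm (Q.toΓSpec_continuous.tendsto x).le_comap fun s hs ↦ ?_
    obtain ⟨t, ht, hto, hx⟩ := mem_nhds_iff.1 hs
    obtain ⟨r, hr, hr'⟩ := hQ.exists_basicOpen x trivial ⟨t, hto⟩ hx
    refine ⟨SetLike.coe (PrimeSpectrum.basicOpen r), (PrimeSpectrum.basicOpen r).2.mem_nhds ?_, ?_⟩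
    · exact (Set.ext_iff.1 (hpre r) x).2 hr
    · exact (hpre r).subset.trans (subset_trans hr' ht)
  · intro q
    obtain ⟨p, -, hp⟩ := hQ.exists_of_prime q.asIdeal q.2
    refine ⟨p, PrimeSpectrum.ext (Ideal.ext fun r ↦ Iff.trans ?_ (hp r).symm)⟩
    rw [← not_iff_not, not_not]
    exact Set.ext_iff.1 (hpre r) p

lemma bijective_toΓSpecSheafedSpace_app {Q : LocallyRingedSpace.{u}} (hQ : LooksAffine Q ⊤)
    (r : Q.presheaf.obj (op ⊤)) :
    Function.Bijective
      (Q.toΓSpecSheafedSpace.hom.c.app (op (PrimeSpectrum.basicOpen r))).hom := by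
  have (V : Opens Q.toTopCat) (e : V = Q.toRingedSpace.basicOpen r) :
      (∀ s : Q.presheaf.obj (op ⊤), Q.presheaf.map V.leTop.op s = 0 →
        ∃ n : ℕ, r ^ n * s = 0) ∧
      (∀ t, ∃ (n : ℕ) (s : Q.presheaf.obj (op ⊤)), Q.presheaf.map V.leTop.op s =
        Q.presheaf.map V.leTop.op r ^ n * t) := by
    subst e
    exact ⟨hQ.exists_pow_mul_eq_zero r, hQ.exists_map_eq r⟩
  have h := this _ (Q.toΓSpecMapBasicOpen_eq r)
  exact (StructureSheaf.IsLocalization.to_basicOpen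
    (Q.presheaf.obj (op ⊤)) r).bijective_of_comp_algebraMap
    _ _ (congr_arg CommRingCat.Hom.hom (Q.toΓSpecSheafedSpace_app_spec r)) h.1 h.2

lemma isIso_toΓSpec {Q : LocallyRingedSpace.{u}} [T0Space Q.toTopCat]
    (hQ : LooksAffine Q ⊤) : IsIso Q.toΓSpec := by
  have h1 : IsIso Q.toΓSpec.base :=
    (TopCat.isIso_iff_isHomeomorph _).2 hQ.isHomeomorph_toΓSpecFun
  have h2 : IsIso Q.toΓSpec.c := by
    let F : TopCat.Sheaf CommRingCat (Spec.topObj (LocallyRingedSpace.Γ.obj (op Q))) :=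
      (Spec.locallyRingedSpaceObj (LocallyRingedSpace.Γ.obj (op Q))).𝒪
    let G := (TopCat.Sheaf.pushforward _ Q.toΓSpecBase).obj Q.𝒪
    let α : F ⟶ G := ⟨Q.toΓSpec.c⟩
    have : IsIso α := TopCat.Sheaf.isIso_iff_isIso_basis PrimeSpectrum.isBasis_basic_opens
      fun r ↦ (ConcreteCategory.isIso_iff_bijective _).2 (hQ.bijective_toΓSpecSheafedSpace_app r)
    exact @Functor.map_isIso _ _ _ _ _ _ (sheafToPresheaf _ _) α this
  have : IsIso (SheafedSpace.forgetToPresheafedSpace.map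
      (LocallyRingedSpace.forgetToSheafedSpace.map Q.toΓSpec)) :=
    @PresheafedSpace.isIso_of_components _ _ _ _ _ h1 h2
  have := isIso_of_reflects_iso (LocallyRingedSpace.forgetToSheafedSpace.map Q.toΓSpec)
    SheafedSpace.forgetToPresheafedSpace
  exact isIso_of_reflects_iso _ LocallyRingedSpace.forgetToSheafedSpace

lemma mem_basicOpen_restrict (P : LocallyRingedSpace.{u}) (W : Opens P.toTopCat)
    (r : P.presheaf.obj (op (W.isOpenEmbedding.isOpenMap.functor.obj ⊤))) (p : W) :
    (show (P.restrict W.isOpenEmbedding).toTopCat from p) ∈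
      (P.restrict W.isOpenEmbedding).toRingedSpace.basicOpen (U := ⊤) r ↔
      p.1 ∈ P.toRingedSpace.basicOpen r := by
  have h : p.1 ∈ W.isOpenEmbedding.isOpenMap.functor.obj ⊤ := ⟨p, trivial, rfl⟩
  have key := P.toPresheafedSpace.restrictStalkIso_hom_eq_germ_apply W.isOpenEmbedding ⊤ p trivial r
  rw [RingedSpace.mem_basicOpen _ _ p.1 h]
  refine (RingedSpace.mem_basicOpen (P.restrict W.isOpenEmbedding).toRingedSpace (U := ⊤)
    _ _ trivial).trans ?_
  erw [← key]
  exact (isUnit_map_iff (PresheafedSpace.restrictStalkIso _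
    W.isOpenEmbedding p).commRingCatIsoToRingEquiv _).symm

lemma restrict {P : LocallyRingedSpace.{u}} {W : Opens P.toTopCat} (hW : LooksAffine P W) :
    LooksAffine (P.restrict W.isOpenEmbedding) ⊤ := by
  have e : W.isOpenEmbedding.isOpenMap.functor.obj ⊤ = W := by ext; simp
  have h : LooksAffine P (W.isOpenEmbedding.isOpenMap.functor.obj ⊤) := by
    convert hW
  have hb (r : P.presheaf.obj (op (W.isOpenEmbedding.isOpenMap.functor.obj ⊤))) :
      W.isOpenEmbedding.isOpenMap.functor.obj
        ((P.restrict W.isOpenEmbedding).toRingedSpace.basicOpen (U := ⊤) r) =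
        P.toRingedSpace.basicOpen r := by
    ext p
    constructor
    · rintro ⟨q, hq, rfl⟩
      exact (mem_basicOpen_restrict P W r q).1 hq
    · intro hp
      exact ⟨⟨p, e.le (P.toRingedSpace.basicOpen_le r hp)⟩,
        (mem_basicOpen_restrict P W r _).2 hp, rfl⟩
  constructor
  · intro p _ W' hp
    obtain ⟨r, hr, hr'⟩ := h.exists_basicOpen p.1 (by rw [e]; exact p.2)
      (W.isOpenEmbedding.isOpenMap.functor.obj W') ⟨p, hp, rfl⟩
    refine ⟨r, (mem_basicOpen_restrict P W r _).2 hr, fun q hq ↦ ?_⟩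
    obtain ⟨q', hq', h⟩ := hr' ((mem_basicOpen_restrict P W r q).1 hq)
    obtain rfl := Subtype.ext h
    exact hq'
  · intro I hI
    obtain ⟨p, hp, hI⟩ := h.exists_of_prime I hI
    exact ⟨⟨p, e.le hp⟩, trivial,
      fun r ↦ (hI r).trans (not_congr (mem_basicOpen_restrict P W r ⟨p, e.le hp⟩).symm)⟩
  · intro r s hs
    have (V : Opens P.toTopCat) (e : V = P.toRingedSpace.basicOpen r)
        (hV : V ≤ W.isOpenEmbedding.isOpenMap.functor.obj ⊤)
        (hs : P.presheaf.map (homOfLE hV).op s = 0) :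
        ∃ n : ℕ, (r : P.presheaf.obj
          (op (W.isOpenEmbedding.isOpenMap.functor.obj ⊤))) ^ n * s = 0 := by
      subst e
      exact h.exists_pow_mul_eq_zero r s hs
    exact this _ (hb r) _ hs
  · intro r
    have (V : Opens P.toTopCat) (e : V = P.toRingedSpace.basicOpen r)
        (hV : V ≤ W.isOpenEmbedding.isOpenMap.functor.obj ⊤) (t : P.presheaf.obj (op V)) :
        ∃ (n : ℕ) (s : P.presheaf.obj (op (W.isOpenEmbedding.isOpenMap.functor.obj ⊤))),
          P.presheaf.map (homOfLE hV).op s = P.presheaf.map (homOfLE hV).op r ^ n * t := by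
      subst e
      exact h.exists_map_eq r t
    exact this _ (hb r) _

end LooksAffine

/-- The preimage of an open subset along a morphism from a scheme to a locally ringed space. -/
def preim {X : Scheme.{u}} {P : LocallyRingedSpace.{u}} (i : X.toLocallyRingedSpace ⟶ P)
    (W : Opens P.toTopCat) : X.Opens := (Opens.map i.base).obj W

/-- Pullback of sections along a morphism from a scheme to a locally ringed space. -/
noncomputable def pull {X : Scheme.{u}} {P : LocallyRingedSpace.{u}}
    (i : X.toLocallyRingedSpace ⟶ P) (W : Opens P.toTopCat) :
    P.presheaf.obj (op W) →+* Γ(X, preim i W) := (i.c.app (op W)).hom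

section

variable {X : Scheme.{u}} {P : LocallyRingedSpace.{u}} (i : X.toLocallyRingedSpace ⟶ P)

lemma mem_preim {W : Opens P.toTopCat} {x : X} : x ∈ preim i W ↔ i.base x ∈ W := Iff.rfl

lemma preim_mono {W W' : Opens P.toTopCat} (h : W' ≤ W) : preim i W' ≤ preim i W :=
  fun _ hx ↦ h hx

lemma pull_res {W W' : Opens P.toTopCat} (h : W' ≤ W) (s : P.presheaf.obj (op W)) :
    pull i W' (P.presheaf.map (homOfLE h).op s) =
      X.presheaf.map (homOfLE (preim_mono i h)).op (pull i W s) :=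
  ConcreteCategory.congr_hom (i.c.naturality (homOfLE h).op) s

lemma preim_basicOpen {W : Opens P.toTopCat} (s : P.presheaf.obj (op W)) :
    preim i (P.toRingedSpace.basicOpen s) = X.basicOpen (pull i W s) :=
  LocallyRingedSpace.preimage_basicOpen i s

end

lemma AlgebraicGeometry.IsAffineOpen.exists_appLE_eq {X Z : Scheme.{u}} {f : Z ⟶ X}
    [IsClosedImmersion f] {U : X.Opens} (hU : IsAffineOpen U)
    {T : Z.Opens} (hT : T = f ⁻¹ᵁ U) (c : Γ(Z, T)) : ∃ a, f.appLE U T hT.le a = c := by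
  subst hT
  obtain ⟨a, ha⟩ := f.app_surjective U hU c
  exact ⟨a, by rw [Scheme.Hom.appLE_eq_app]; exact ha⟩

lemma AlgebraicGeometry.IsAffineOpen.exists_pow_mul_eq_zero {X : Scheme.{u}} {U D : X.Opens}
    (hU : IsAffineOpen U) {a : Γ(X, U)} (hD : D = X.basicOpen a) (hDU : D ≤ U) {x : Γ(X, U)}
    (hx : X.presheaf.map (homOfLE hDU).op x = 0) : ∃ n : ℕ, a ^ n * x = 0 := by
  subst hD
  exact exists_pow_mul_eq_zero_of_res_basicOpen_eq_zero_of_isAffineOpen X hU x a hx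

lemma AlgebraicGeometry.IsAffineOpen.exists_map_eq {X : Scheme.{u}} {U D : X.Opens}
    (hU : IsAffineOpen U) {a : Γ(X, U)} (hD : D = X.basicOpen a) (hDU : D ≤ U) (t : Γ(X, D)) :
    ∃ (n : ℕ) (x : Γ(X, U)), X.presheaf.map (homOfLE hDU).op x =
      X.presheaf.map (homOfLE hDU).op a ^ n * t := by
  subst hD
  exact exists_eq_pow_mul_of_isAffineOpen X U hU a t

/-- A commutative square of schemes `X ← Z → Y` over a locally ringed space `P` exhibiting `P`
as the pushout on the level of topologies and of sections over opens. -/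
structure IsGluing {X Y Z : Scheme.{u}} {P : LocallyRingedSpace.{u}} (f : Z ⟶ X) (g : Z ⟶ Y)
    (i : X.toLocallyRingedSpace ⟶ P) (j : Y.toLocallyRingedSpace ⟶ P) : Prop where
  w : f.toLRSHom ≫ i = g.toLRSHom ≫ j
  exists_preimage (p : P.toTopCat) : (∃ x, i.base x = p) ∨ ∃ y, j.base y = p
  exists_opens (U : X.Opens) (V : Y.Opens) (h : f ⁻¹ᵁ U = g ⁻¹ᵁ V) :
    ∃ W : Opens P.toTopCat, preim i W = U ∧ preim j W = V
  section_ext (W : Opens P.toTopCat) (s t : P.presheaf.obj (op W))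
    (h : pull i W s = pull i W t) (h' : pull j W s = pull j W t) : s = t
  exists_section (W : Opens P.toTopCat) (T : Z.Opens) (hf : T = f ⁻¹ᵁ preim i W)
    (hg : T = g ⁻¹ᵁ preim j W) (a : Γ(X, preim i W)) (b : Γ(Y, preim j W))
    (h : f.appLE _ T hf.le a = g.appLE _ T hg.le b) :
    ∃ s, pull i W s = a ∧ pull j W s = b

namespace IsGluing

variable {X Y Z : Scheme.{u}} {P : LocallyRingedSpace.{u}} {f : Z ⟶ X} {g : Z ⟶ Y}
    {i : X.toLocallyRingedSpace ⟶ P} {j : Y.toLocallyRingedSpace ⟶ P}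

lemma symm (h : IsGluing f g i j) : IsGluing g f j i where
  w := h.w.symm
  exists_preimage p := (h.exists_preimage p).symm
  exists_opens U V e := (h.exists_opens V U e.symm).imp fun _ ↦ And.symm
  section_ext W s t e e' := h.section_ext W s t e' e
  exists_section W T hf hg a b e :=
    (h.exists_section W T hg hf b a e.symm).imp fun _ ↦ And.symm

variable (h : IsGluing f g i j)
include h

lemma base_eq (z : Z) : i.base (f z) = j.base (g z) :=
  ConcreteCategory.congr_hom (congr_arg (fun k : Z.toLocallyRingedSpace ⟶ P ↦ k.base) h.w) z

lemma preim_eq (W : Opens P.toTopCat) : f ⁻¹ᵁ preim i W = g ⁻¹ᵁ preim j W := by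
  ext z
  change i.base (f z) ∈ W ↔ j.base (g z) ∈ W
  rw [h.base_eq]

lemma appLE_pull (W : Opens P.toTopCat) (T : Z.Opens) (hf : T ≤ f ⁻¹ᵁ preim i W)
    (hg : T ≤ g ⁻¹ᵁ preim j W) (s : P.presheaf.obj (op W)) :
    f.appLE _ T hf (pull i W s) = g.appLE _ T hg (pull j W s) := by
  have key (k k' : Z.toLocallyRingedSpace ⟶ P) (e : k = k') (hk : T ≤ preim k W)
      (hk' : T ≤ preim k' W) : Z.presheaf.map (homOfLE hk).op (pull k W s) =
        Z.presheaf.map (homOfLE hk').op (pull k' W s) := by subst e; rfl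
  exact key _ _ h.w hf hg

variable [IsClosedImmersion f] [IsClosedImmersion g]

omit [IsClosedImmersion f] in
lemma exists_preim_eq (U : X.Opens) : ∃ W : Opens P.toTopCat, preim i W = U := by
  obtain ⟨V, hV, e⟩ := g.isClosedEmbedding.isInducing.isOpen_iff.1 (f ⁻¹ᵁ U).2
  obtain ⟨W, hW, -⟩ := h.exists_opens U ⟨V, hV⟩ (Opens.ext e.symm)
  exact ⟨W, hW⟩

omit [IsClosedImmersion g] in
lemma exists_preim_eq_bot {x : X} (hx : x ∉ Set.range f) : ∃ W : Opens P.toTopCat,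
    i.base x ∈ W ∧ preim j W = ⊥ := by
  obtain ⟨W, hW, hW'⟩ := h.exists_opens
    ⟨(Set.range f)ᶜ, f.isClosedEmbedding.isClosed_range.isOpen_compl⟩ ⊥ (by ext z; simp)
  refine ⟨W, ?_, hW'⟩
  rw [← mem_preim, hW]
  exact hx

omit [IsClosedImmersion f] [IsClosedImmersion g] in
lemma exists_apply_eq (p : P.toTopCat) : (∃ z, i.base (f z) = p ∧ j.base (g z) = p) ∨
    (∃ x, x ∉ Set.range f ∧ i.base x = p) ∨ (∃ y, y ∉ Set.range g ∧ j.base y = p) := by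
  obtain ⟨x, rfl⟩ | ⟨y, rfl⟩ := h.exists_preimage p
  · by_cases hx : x ∈ Set.range f
    · obtain ⟨z, rfl⟩ := hx
      exact .inl ⟨z, rfl, (h.base_eq z).symm⟩
    · exact .inr (.inl ⟨x, hx, rfl⟩)
  · by_cases hy : y ∈ Set.range g
    · obtain ⟨z, rfl⟩ := hy
      exact .inl ⟨z, h.base_eq z, rfl⟩
    · exact .inr (.inr ⟨y, hy, rfl⟩)

omit [IsClosedImmersion f] in
lemma eq_of_inseparable {x x' : X} (e : Inseparable (X := P.toTopCat) (i.base x) (i.base x')) :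
    x = x' := by
  refine Inseparable.eq (inseparable_iff_forall_isOpen.2 fun U hU ↦ ?_)
  obtain ⟨W, hW⟩ := h.exists_preim_eq ⟨U, hU⟩
  have := inseparable_iff_forall_isOpen.1 e W W.2
  have h' (x) : x ∈ U ↔ i.base x ∈ W := by rw [← mem_preim, hW]; rfl
  rw [h', h']
  exact this

omit [IsClosedImmersion g] in
lemma not_inseparable {x : X} (hx : x ∉ Set.range f) (y : Y) :
    ¬ Inseparable (X := P.toTopCat) (i.base x) (j.base y) := by
  intro e
  obtain ⟨W, hW, hW'⟩ := h.exists_preim_eq_bot hx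
  have : y ∈ preim j W := (inseparable_iff_forall_isOpen.1 e W W.2).1 hW
  rw [hW'] at this
  exact this

lemma t0Space : T0Space P.toTopCat := by
  refine ⟨fun p q e ↦ ?_⟩
  obtain ⟨z, rfl, hp⟩ | ⟨x, hx, rfl⟩ | ⟨y, hy, rfl⟩ := h.exists_apply_eq p <;>
    obtain ⟨z', rfl, hq⟩ | ⟨x', hx', rfl⟩ | ⟨y', hy', rfl⟩ := h.exists_apply_eq q
  · exact congr_arg _ (h.eq_of_inseparable e)
  · exact congr_arg _ (h.eq_of_inseparable e)
  · rw [← hp] at e ⊢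
    exact congr_arg _ (h.symm.eq_of_inseparable e)
  · exact congr_arg _ (h.eq_of_inseparable e)
  · exact congr_arg _ (h.eq_of_inseparable e)
  · exact (h.not_inseparable hx _ e).elim
  · exact (h.symm.not_inseparable hy _ e).elim
  · exact (h.symm.not_inseparable hy _ e).elim
  · exact congr_arg _ (h.symm.eq_of_inseparable e)

lemma exists_isAffineOpen (p : P.toTopCat) :
    ∃ W, p ∈ W ∧ IsAffineOpen (preim i W) ∧ IsAffineOpen (preim j W) := by
  have key {X Y Z : Scheme.{u}} {f : Z ⟶ X} {g : Z ⟶ Y}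
      {i : X.toLocallyRingedSpace ⟶ P} {j : Y.toLocallyRingedSpace ⟶ P} (h : IsGluing f g i j)
      [IsClosedImmersion f] (x : X) (hx : x ∉ Set.range f) :
      ∃ W, i.base x ∈ W ∧ IsAffineOpen (preim i W) ∧ IsAffineOpen (preim j W) := by
    obtain ⟨U, hU, hxU, hU'⟩ := exists_isAffineOpen_mem_and_subset
      (U := ⟨(Set.range f)ᶜ, f.isClosedEmbedding.isClosed_range.isOpen_compl⟩) (x := x) hx
    obtain ⟨W, rfl, hW'⟩ := h.exists_opens U ⊥ (by
      ext z
      exact ⟨fun hz ↦ hU' hz ⟨z, rfl⟩, False.elim⟩)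
    exact ⟨W, hxU, hU, hW' ▸ isAffineOpen_bot _⟩
  obtain ⟨z, rfl, -⟩ | ⟨x, hx, rfl⟩ | ⟨y, hy, rfl⟩ := h.exists_apply_eq p
  · obtain ⟨U₀, hU₀, hzU₀, -⟩ := exists_isAffineOpen_mem_and_subset (U := ⊤) (x := f z) trivial
    obtain ⟨V₀, hV₀, e₀⟩ := g.isClosedEmbedding.isInducing.isOpen_iff.1 (f ⁻¹ᵁ U₀).2
    obtain ⟨V₁, hV₁, hzV₁, hV₁'⟩ := exists_isAffineOpen_mem_and_subset (U := ⟨V₀, hV₀⟩) (x := g z)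
      (e₀.symm.subset hzU₀)
    have hle : g ⁻¹ᵁ V₁ ≤ f ⁻¹ᵁ U₀ := fun z hz ↦ e₀.subset (hV₁' hz)
    obtain ⟨U₁, hU₁, e₁⟩ := f.isClosedEmbedding.isInducing.isOpen_iff.1 (g ⁻¹ᵁ V₁).2
    obtain ⟨a, haU, hza⟩ := hU₀.exists_basicOpen_le (V := ⟨U₁, hU₁⟩) ⟨f z, e₁.symm.subset hzV₁⟩ hzU₀
    obtain ⟨b, hb⟩ := hV₁.exists_appLE_eq (f := g) rfl (f.appLE _ _ hle a)
    have e : f ⁻¹ᵁ X.basicOpen a = g ⁻¹ᵁ Y.basicOpen b := by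
      have hb' := congr_arg Z.basicOpen hb
      rw [Scheme.basicOpen_appLE, Scheme.basicOpen_appLE] at hb'
      rw [inf_eq_right.2, inf_eq_right.2] at hb'
      · exact hb'.symm
      · exact fun z hz ↦ e₁.subset (haU hz)
      · exact fun z hz ↦ Y.basicOpen_le b hz
    obtain ⟨W, hW, hW'⟩ := h.exists_opens _ _ e
    refine ⟨W, ?_, hW ▸ hU₀.basicOpen a, hW' ▸ hV₁.basicOpen b⟩
    rw [← mem_preim, hW]
    exact hza
  · exact key h x hx
  · obtain ⟨W, h₁, h₂, h₃⟩ := key h.symm y hy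
    exact ⟨W, h₁, h₃, h₂⟩

variable {W : Opens P.toTopCat} (hU : IsAffineOpen (preim i W)) (hV : IsAffineOpen (preim j W))
include hU hV

omit [IsClosedImmersion f] [IsClosedImmersion g] in
lemma exists_pow_mul_eq_zero (r s : P.presheaf.obj (op W))
    (hs : P.presheaf.map (homOfLE (P.toRingedSpace.basicOpen_le r)).op s = 0) :
    ∃ n : ℕ, r ^ n * s = 0 := by
  obtain ⟨n, hn⟩ := hU.exists_pow_mul_eq_zero (preim_basicOpen i r)
    (preim_mono i (P.toRingedSpace.basicOpen_le r)) (x := pull i W s)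
    ((pull_res i _ s).symm.trans ((congr_arg _ hs).trans (map_zero _)))
  obtain ⟨m, hm⟩ := hV.exists_pow_mul_eq_zero (preim_basicOpen j r)
    (preim_mono j (P.toRingedSpace.basicOpen_le r)) (x := pull j W s)
    ((pull_res j _ s).symm.trans ((congr_arg _ hs).trans (map_zero _)))
  refine ⟨n + m, h.section_ext _ _ _ ?_ ?_⟩
  · rw [map_mul, map_pow, map_zero, add_comm, pow_add, mul_assoc, hn, mul_zero]
  · rw [map_mul, map_pow, map_zero, pow_add, mul_assoc, hm, mul_zero]

omit h hV [IsClosedImmersion g] in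
lemma exists_pow_appLE_eq_zero {T : Z.Opens} (hf : T = f ⁻¹ᵁ preim i W) (c : Γ(Z, T))
    (hc : Z.basicOpen c = ⊥) : ∃ n : ℕ, c ^ n = 0 := by
  have hT : IsAffineOpen T := hf ▸ hU.preimage f
  have : Subsingleton Γ(Z, ⊥) := CommRingCat.subsingleton_of_isTerminal
    (TopCat.Sheaf.isTerminalOfEmpty Z.sheaf)
  obtain ⟨n, hn⟩ := hT.exists_pow_mul_eq_zero hc.symm bot_le (x := 1) (Subsingleton.elim _ _)
  exact ⟨n, by simpa using hn⟩

omit [IsClosedImmersion g] in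
lemma exists_map_eq (r : P.presheaf.obj (op W)) {D : Opens P.toTopCat}
    (hD' : D = P.toRingedSpace.basicOpen r) (hD : D ≤ W) (t : P.presheaf.obj (op D)) :
    ∃ (n : ℕ) (s : P.presheaf.obj (op W)), P.presheaf.map (homOfLE hD).op s =
      P.presheaf.map (homOfLE hD).op r ^ n * t := by
  have hDi : preim i D = X.basicOpen (pull i W r) := hD' ▸ preim_basicOpen i r
  have hDj : preim j D = Y.basicOpen (pull j W r) := hD' ▸ preim_basicOpen j r
  obtain ⟨n, a, ha⟩ := hU.exists_map_eq hDi (preim_mono i hD) (pull i _ t)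
  obtain ⟨m, b, hb⟩ := hV.exists_map_eq hDj (preim_mono j hD) (pull j _ t)
  obtain ⟨T, hf⟩ : ∃ T, T = f ⁻¹ᵁ preim i W := ⟨_, rfl⟩
  have hg : T = g ⁻¹ᵁ preim j W := hf.trans (h.preim_eq W)
  obtain ⟨E, hfE⟩ : ∃ E, E = f ⁻¹ᵁ preim i D := ⟨_, rfl⟩
  have hgE : E = g ⁻¹ᵁ preim j D := hfE.trans (h.preim_eq D)
  have hET : E ≤ T := by rw [hf, hfE]; exact fun z hz ↦ hD hz
  have hT : IsAffineOpen T := hf ▸ hU.preimage f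
  have hE : E = Z.basicOpen (f.appLE _ T hf.le (pull i W r)) := by
    rw [Scheme.basicOpen_appLE, ← hDi, ← hfE, inf_eq_right.2 hET]
  have ha' : X.presheaf.map (homOfLE (preim_mono i hD)).op (pull i W r ^ m * a) =
      pull i D (P.presheaf.map (homOfLE hD).op r ^ (n + m) * t) := by
    rw [map_mul, map_pow, ha, map_mul, map_pow, pull_res, ← mul_assoc, ← pow_add, add_comm]
  have hb' : Y.presheaf.map (homOfLE (preim_mono j hD)).op (pull j W r ^ n * b) =
      pull j D (P.presheaf.map (homOfLE hD).op r ^ (n + m) * t) := by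
    rw [map_mul, map_pow, hb, map_mul, map_pow, pull_res, ← mul_assoc, ← pow_add]
  generalize pull i W r ^ m * a = a at ha'
  generalize pull j W r ^ n * b = b at hb'
  generalize n + m = N at ha' hb'
  have hfa : Z.presheaf.map (homOfLE hET).op (f.appLE _ T hf.le a) =
      f.appLE _ E hfE.le (X.presheaf.map (homOfLE (preim_mono i hD)).op a) := by
    rw [← CommRingCat.comp_apply, ← CommRingCat.comp_apply, Scheme.Hom.appLE_map,
      Scheme.Hom.map_appLE]
  have hgb : Z.presheaf.map (homOfLE hET).op (g.appLE _ T hg.le b) =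
      g.appLE _ E hgE.le (Y.presheaf.map (homOfLE (preim_mono j hD)).op b) := by
    rw [← CommRingCat.comp_apply, ← CommRingCat.comp_apply, Scheme.Hom.appLE_map,
      Scheme.Hom.map_appLE]
  obtain ⟨k, hk⟩ := hT.exists_pow_mul_eq_zero hE hET
    (x := f.appLE _ T hf.le a - g.appLE _ T hg.le b) (by
      rw [map_sub, hfa, hgb, ha', hb', h.appLE_pull D E hfE.le hgE.le, sub_self])
  obtain ⟨s, hsa, hsb⟩ := h.exists_section W T hf hg (pull i W r ^ k * a) (pull j W r ^ k * b) (by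
    rw [mul_sub, sub_eq_zero] at hk
    rw [map_mul, map_pow, hk, map_mul, map_pow, h.appLE_pull W T hf.le hg.le])
  refine ⟨k + N, s, h.section_ext _ _ _ ?_ ?_⟩
  · rw [pow_add, mul_assoc, map_mul, map_pow, ← ha', pull_res, hsa, map_mul, map_pow, ← pull_res]
  · rw [pow_add, mul_assoc, map_mul, map_pow, ← hb', pull_res, hsb, map_mul, map_pow, ← pull_res]

lemma exists_basicOpen {p : P.toTopCat} (hp : p ∈ W) {W' : Opens P.toTopCat} (hp' : p ∈ W') :
    ∃ r : P.presheaf.obj (op W),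
      p ∈ P.toRingedSpace.basicOpen r ∧ P.toRingedSpace.basicOpen r ≤ W' := by
  have mem {r : P.presheaf.obj (op W)} {x : X} :
      i.base x ∈ P.toRingedSpace.basicOpen r ↔ x ∈ X.basicOpen (pull i W r) := by
    rw [← preim_basicOpen]; rfl
  have mem' {r : P.presheaf.obj (op W)} {y : Y} :
      j.base y ∈ P.toRingedSpace.basicOpen r ↔ y ∈ Y.basicOpen (pull j W r) := by
    rw [← preim_basicOpen]; rfl
  have hle {r : P.presheaf.obj (op W)} (h₁ : X.basicOpen (pull i W r) ≤ preim i W')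
      (h₂ : Y.basicOpen (pull j W r) ≤ preim j W') : P.toRingedSpace.basicOpen r ≤ W' := by
    intro p hp
    obtain ⟨x, rfl⟩ | ⟨y, rfl⟩ := h.exists_preimage p
    · exact h₁ (mem.1 hp)
    · exact h₂ (mem'.1 hp)
  obtain ⟨T, hf⟩ : ∃ T, T = f ⁻¹ᵁ preim i W := ⟨_, rfl⟩
  have hg : T = g ⁻¹ᵁ preim j W := hf.trans (h.preim_eq W)
  obtain ⟨z, rfl, hz⟩ | ⟨x, hx, rfl⟩ | ⟨y, hy, rfl⟩ := h.exists_apply_eq p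
  · obtain ⟨a, haW, ha⟩ := hU.exists_basicOpen_le (V := preim i W') ⟨f z, hp'⟩ hp
    rw [← hz] at hp hp'
    obtain ⟨b, hbW, hb⟩ := hV.exists_basicOpen_le (V := preim j W') ⟨g z, hp'⟩ hp
    obtain ⟨a', ha'⟩ := hU.exists_appLE_eq hf (g.appLE _ T hg.le b)
    obtain ⟨b', hb'⟩ := hV.exists_appLE_eq hg (f.appLE _ T hf.le a)
    obtain ⟨r, hra, hrb⟩ := h.exists_section W T hf hg (a * a') (b' * b) (by simp [ha', hb'])
    have hzT : z ∈ T := hg.symm.le hp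
    have hza' : z ∈ Z.basicOpen (f.appLE _ T hf.le a') := by
      rw [ha', Scheme.basicOpen_appLE]
      exact ⟨hzT, hb⟩
    rw [Scheme.basicOpen_appLE] at hza'
    refine ⟨r, ?_, hle ?_ ?_⟩
    · rw [mem, hra, Scheme.basicOpen_mul]
      exact ⟨ha, hza'.2⟩
    · rw [hra, Scheme.basicOpen_mul]
      exact inf_le_left.trans haW
    · rw [hrb, Scheme.basicOpen_mul]
      exact inf_le_right.trans hbW
  · have hc := f.isClosedEmbedding.isClosed_range.isOpen_compl
    obtain ⟨a, haW, ha⟩ := hU.exists_basicOpen_le (V := preim i W' ⊓ ⟨_, hc⟩) ⟨x, hp', hx⟩ hp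
    obtain ⟨n, hn⟩ := exists_pow_appLE_eq_zero hU hf (f.appLE _ T hf.le a) (by
      rw [Scheme.basicOpen_appLE, eq_bot_iff]
      exact fun z hz ↦ (haW hz.2).2 ⟨z, rfl⟩)
    obtain ⟨r, hra, hrb⟩ := h.exists_section W T hf hg (a ^ (n + 1)) 0 (by simp [pow_succ, hn])
    refine ⟨r, ?_, hle ?_ ?_⟩
    · rw [mem, hra, Scheme.basicOpen_pow _ _ n.succ_pos]
      exact ha
    · rw [hra, Scheme.basicOpen_pow _ _ n.succ_pos]
      exact haW.trans inf_le_left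
    · rw [hrb, Scheme.basicOpen_zero]
      exact bot_le
  · have hc := g.isClosedEmbedding.isClosed_range.isOpen_compl
    obtain ⟨b, hbW, hb⟩ := hV.exists_basicOpen_le (V := preim j W' ⊓ ⟨_, hc⟩) ⟨y, hp', hy⟩ hp
    obtain ⟨n, hn⟩ := exists_pow_appLE_eq_zero hV hg (g.appLE _ T hg.le b) (by
      rw [Scheme.basicOpen_appLE, eq_bot_iff]
      exact fun z hz ↦ (hbW hz.2).2 ⟨z, rfl⟩)
    obtain ⟨r, hra, hrb⟩ := h.exists_section W T hf hg 0 (b ^ (n + 1)) (by simp [pow_succ, hn])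
    refine ⟨r, ?_, hle ?_ ?_⟩
    · rw [mem', hrb, Scheme.basicOpen_pow _ _ n.succ_pos]
      exact hb
    · rw [hra, Scheme.basicOpen_zero]
      exact bot_le
    · rw [hrb, Scheme.basicOpen_pow _ _ n.succ_pos]
      exact hbW.trans inf_le_left

omit [IsClosedImmersion f] in
lemma exists_of_prime_of_ker_le {I : Ideal (P.presheaf.obj (op W))} (hI : I.IsPrime)
    (hker : RingHom.ker (pull i W) ≤ I) :
    ∃ p ∈ W, ∀ r, r ∈ I ↔ p ∉ P.toRingedSpace.basicOpen r := by
  have hsurj : Function.Surjective (pull i W) := fun a ↦ by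
    obtain ⟨b, hb⟩ := hV.exists_appLE_eq (h.preim_eq W) (f.appLE _ _ le_rfl a)
    obtain ⟨s, hs, -⟩ := h.exists_section W _ rfl (h.preim_eq W) a b hb.symm
    exact ⟨s, hs⟩
  have hI' : (I.map (pull i W)).IsPrime := Ideal.map_isPrime_of_surjective hsurj hker
  obtain ⟨q, hq⟩ : ∃ q : PrimeSpectrum Γ(X, preim i W), q = ⟨_, hI'⟩ := ⟨_, rfl⟩
  refine ⟨i.base (hU.fromSpec q), hU.range_fromSpec.subset ⟨q, rfl⟩, fun r ↦ ?_⟩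
  have h₁ : i.base (hU.fromSpec q) ∈ P.toRingedSpace.basicOpen r ↔
      hU.fromSpec q ∈ X.basicOpen (pull i W r) := by
    rw [← preim_basicOpen]; rfl
  have h₂ : hU.fromSpec q ∈ X.basicOpen (pull i W r) ↔ pull i W r ∉ I.map (pull i W) := by
    change q ∈ hU.fromSpec ⁻¹ᵁ X.basicOpen (pull i W r) ↔ _
    rw [hU.fromSpec_preimage_basicOpen, hq]
    rfl
  rw [h₁, h₂, not_not, ← Ideal.mem_comap, Ideal.comap_map_of_surjective' _ hsurj,
    sup_eq_left.2 hker]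

lemma looksAffine : LooksAffine P W where
  exists_basicOpen _ hp _ hp' := h.exists_basicOpen hU hV hp hp'
  exists_of_prime I hI := by
    by_cases hi : RingHom.ker (pull i W) ≤ I
    · exact h.exists_of_prime_of_ker_le hU hV hI hi
    by_cases hj : RingHom.ker (pull j W) ≤ I
    · exact h.symm.exists_of_prime_of_ker_le hV hU hI hj
    obtain ⟨s, hs, hsI⟩ := SetLike.not_le_iff_exists.1 hi
    obtain ⟨t, ht, htI⟩ := SetLike.not_le_iff_exists.1 hj
    rw [RingHom.mem_ker] at hs ht
    have : s * t = 0 := h.section_ext _ _ _ (by simp [hs]) (by simp [ht])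
    exact ((hI.mem_or_mem (this ▸ I.zero_mem)).elim hsI htI).elim
  exists_pow_mul_eq_zero := h.exists_pow_mul_eq_zero hU hV
  exists_map_eq r t := h.exists_map_eq hU hV r rfl _ t

end IsGluing

lemma IsGluing.of_isPushout {X Y Z : Scheme.{u}} {P : LocallyRingedSpace.{u}} {f : Z ⟶ X}
    {g : Z ⟶ Y} {i : X.toLocallyRingedSpace ⟶ P} {j : Y.toLocallyRingedSpace ⟶ P}
    (h : IsPushout f.toLRSHom g.toLRSHom i j) : IsGluing f g i j := by
  have h₁ := h.map (LocallyRingedSpace.forgetToSheafedSpace ⋙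
    SheafedSpace.forgetToPresheafedSpace)
  have h₂ := h₁.map (PresheafedSpace.forget _)
  refine ⟨h.w, fun p ↦ TopCat.exists_preimage_of_isPushout h₂ p,
    fun U V e ↦ TopCat.exists_opens_of_isPushout h₂ U V e,
    fun W s t ↦ PresheafedSpace.section_ext_of_isPushout h₁ W s t,
    fun W T hf hg a b e ↦ PresheafedSpace.exists_section_of_isPushout h₁ W a b T hf hg e⟩

/-- A gluing of schemes along closed immersions is a scheme. -/
noncomputable def IsGluing.scheme {X Y Z : Scheme.{u}} {P : LocallyRingedSpace.{u}} {f : Z ⟶ X}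
    {g : Z ⟶ Y} {i : X.toLocallyRingedSpace ⟶ P} {j : Y.toLocallyRingedSpace ⟶ P}
    [IsClosedImmersion f] [IsClosedImmersion g] (h : IsGluing f g i j) : Scheme.{u} where
  __ := P
  local_affine p := by
    obtain ⟨W, hp, hU, hV⟩ := h.exists_isAffineOpen p
    have : T0Space P.toTopCat := h.t0Space
    have : T0Space (P.restrict W.isOpenEmbedding).toTopCat :=
      W.isOpenEmbedding.isEmbedding.t0Space
    have := (h.looksAffine hU hV).restrict.isIso_toΓSpec
    exact ⟨⟨W, hp⟩, _, ⟨@asIso _ _ _ _ (P.restrict W.isOpenEmbedding).toΓSpec this⟩⟩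

/-- Let `f : Z → X` and `g : Z → Y` be closed immersions of schemes.  Then the pushout
`X ⊔_Z Y` of `f` and `g` exists in the category of schemes. -/
theorem hasPushout_of_isClosedImmersion {Z X Y : Scheme.{u}} (f : Z ⟶ X) (g : Z ⟶ Y)
    [IsClosedImmersion f] [IsClosedImmersion g] : HasPushout f g := by
  have h := IsPushout.of_hasPushout f.toLRSHom g.toLRSHom
  let P := (IsGluing.of_isPushout h).scheme
  let F := Scheme.forgetToLocallyRingedSpace
  let i : X ⟶ P := F.preimage (X := X) (Y := P) (pushout.inl f.toLRSHom g.toLRSHom)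
  let j : Y ⟶ P := F.preimage (X := Y) (Y := P) (pushout.inr f.toLRSHom g.toLRSHom)
  have hi : F.map i = pushout.inl f.toLRSHom g.toLRSHom := F.map_preimage _
  have hj : F.map j = pushout.inr f.toLRSHom g.toLRSHom := F.map_preimage _
  have hF : IsPushout (F.map f) (F.map g) (F.map i) (F.map j) := by
    rw [hi, hj]
    exact h
  exact (IsPushout.of_map F (F.map_injective (by simpa using hF.w)) hF).hasPushout
end

section
/- Let f : Z → X and g : Z → Y be closed immersions of schemes, and suppose the square with legs f, g and coprojections X → W, Y → W is a pushout square in the category of schemes. Then both coprojections X → W and Y → W are closed immersions. -/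
open AlgebraicGeometry CategoryTheory CategoryTheory.Limits

universe u

namespace AlgebraicGeometry

open Opposite TopologicalSpace

theorem presheaf_map_map {T : TopCat.{u}} (F : T.Presheaf CommRingCat.{u}) {A B C : (Opens T)ᵒᵖ}
    (i : A ⟶ B) (j : B ⟶ C) (k : A ⟶ C) (x : F.obj A) : F.map j (F.map i x) = F.map k x := by
  rw [← ConcreteCategory.comp_apply, ← Functor.map_comp]
  rfl

/-- Two sections of a pushout of presheafed spaces agree if their pullbacks to both legs agree. -/
theorem presheafedSpace_section_ext_of_isPushout
    {Z X Y P : PresheafedSpace.{u, u + 1, u} CommRingCat.{u}}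
    {f : Z ⟶ X} {g : Z ⟶ Y} {inl : X ⟶ P} {inr : Y ⟶ P} (h : IsPushout f g inl inr)
    (U : Opens P) (s t : P.presheaf.obj (op U))
    (hl : inl.c.app (op U) s = inl.c.app (op U) t)
    (hr : inr.c.app (op U) s = inr.c.app (op U) t) : s = t := by
  let e : Limits.colimit (span f g) ≅ P := h.isoPushout.symm
  have el : colimit.ι (span f g) WalkingSpan.left ≫ e.hom = inl := h.inl_isoPushout_inv
  have er : colimit.ι (span f g) WalkingSpan.right ≫ e.hom = inr := h.inr_isoPushout_inv
  clear_value e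
  subst el er
  let V := (Opens.map e.hom.base).obj U
  let L := PresheafedSpace.colimitPresheafObjIsoComponentwiseLimit (span f g) V
  have : IsIso e.hom.c := PresheafedSpace.c_isIso_of_iso e.hom
  have : IsIso (e.hom.c.app (op U)) := NatIso.isIso_app_of_isIso _ _
  apply (ConcreteCategory.bijective_of_isIso (e.hom.c.app (op U))).1
  apply (ConcreteCategory.bijective_of_isIso L.hom).1
  have key (j) (hj : (colimit.ι (span f g) j).c.app (op V) (e.hom.c.app (op U) s) =
    (colimit.ι (span f g) j).c.app (op V) (e.hom.c.app (op U) t)) :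
      limit.π (PresheafedSpace.componentwiseDiagram (span f g) V) (op j)
          (L.hom (e.hom.c.app (op U) s)) =
      limit.π (PresheafedSpace.componentwiseDiagram (span f g) V) (op j)
          (L.hom (e.hom.c.app (op U) t)) := by
    have H := PresheafedSpace.colimitPresheafObjIsoComponentwiseLimit_hom_π (span f g) V j
    rw [← H] at hj
    exact hj
  have kl := key .left hl
  have kr := key .right hr
  apply Concrete.limit_ext
  rintro ⟨_ | _ | _⟩
  · rw [← limit.w (PresheafedSpace.componentwiseDiagram (span f g) V)
      (Quiver.Hom.op WalkingSpan.Hom.fst)]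
    rw [ConcreteCategory.comp_apply, ConcreteCategory.comp_apply]
    exact congrArg _ kl
  · exact kl
  · exact kr

/-- Sections on the two legs of a pushout of presheafed spaces which agree on the apex come from
a section on the pushout. -/
theorem presheafedSpace_exists_section_of_isPushout
    {Z X Y P : PresheafedSpace.{u, u + 1, u} CommRingCat.{u}}
    {f : Z ⟶ X} {g : Z ⟶ Y} {inl : X ⟶ P} {inr : Y ⟶ P} (h : IsPushout f g inl inr)
    (U : Opens P) (T : Opens Z)
    (e₁ : T = (Opens.map f.base).obj ((Opens.map inl.base).obj U))
    (e₂ : T = (Opens.map g.base).obj ((Opens.map inr.base).obj U))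
    (a : X.presheaf.obj (op ((Opens.map inl.base).obj U)))
    (b : Y.presheaf.obj (op ((Opens.map inr.base).obj U)))
    (hab : Z.presheaf.map (eqToHom e₁).op (f.c.app (op _) a) =
      Z.presheaf.map (eqToHom e₂).op (g.c.app (op _) b)) :
    ∃ s : P.presheaf.obj (op U), inl.c.app (op U) s = a ∧ inr.c.app (op U) s = b := by
  let e : Limits.colimit (span f g) ≅ P := h.isoPushout.symm
  have el : colimit.ι (span f g) WalkingSpan.left ≫ e.hom = inl := h.inl_isoPushout_inv
  have er : colimit.ι (span f g) WalkingSpan.right ≫ e.hom = inr := h.inr_isoPushout_inv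
  clear_value e
  subst el er
  let V := (Opens.map e.hom.base).obj U
  let L := PresheafedSpace.colimitPresheafObjIsoComponentwiseLimit (span f g) V
  let D := PresheafedSpace.componentwiseDiagram (span f g) V
  have e₀ : (Opens.map (colimit.ι (span f g) WalkingSpan.zero).base).obj V = T := by
    rw [e₁, ← colimit.w (span f g) WalkingSpan.Hom.fst]; rfl
  let c : Z.presheaf.obj (op ((Opens.map (colimit.ι (span f g) WalkingSpan.zero).base).obj V)) :=
    Z.presheaf.map (eqToHom e₀).op (Z.presheaf.map (eqToHom e₁).op (f.c.app (op _) a))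
  let σ : (j : WalkingSpanᵒᵖ) → D.obj j := fun j ↦ match j with
    | ⟨none⟩ => c
    | ⟨some .left⟩ => a
    | ⟨some .right⟩ => b
  have hσ : σ ∈ (D ⋙ CategoryTheory.forget CommRingCat).sections := by
    rintro ⟨i⟩ ⟨j⟩ ⟨(φ : WidePushoutShape.Hom j i)⟩
    cases φ with
    | id =>
      exact ConcreteCategory.congr_hom (D.map_id _) _
    | init k =>
      cases k
      · change Z.presheaf.map (eqToHom _) (f.c.app _ a) = Z.presheaf.map (eqToHom e₀).op
          (Z.presheaf.map (eqToHom e₁).op (f.c.app (op _) a))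
        exact (presheaf_map_map Z.presheaf _ _ _ _).symm
      · change Z.presheaf.map (eqToHom _) (g.c.app _ b) = Z.presheaf.map (eqToHom e₀).op
          (Z.presheaf.map (eqToHom e₁).op (f.c.app (op _) a))
        rw [hab]
        exact (presheaf_map_map Z.presheaf _ _ _ _).symm
  let l := (Types.isLimitEquivSections (isLimitOfPreserves (CategoryTheory.forget CommRingCat)
    (limit.isLimit D))).symm ⟨σ, hσ⟩
  have hl (j) : limit.π D j l = σ j :=
    Types.isLimitEquivSections_symm_apply (isLimitOfPreserves (CategoryTheory.forget CommRingCat)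
    (limit.isLimit D)) ⟨σ, hσ⟩ j
  have : IsIso e.hom.c := PresheafedSpace.c_isIso_of_iso e.hom
  have : IsIso (e.hom.c.app (op U)) := NatIso.isIso_app_of_isIso _ _
  obtain ⟨s, hs⟩ := (ConcreteCategory.bijective_of_isIso (e.hom.c.app (op U))).2 (L.inv l)
  have key (j) : (colimit.ι (span f g) j).c.app (op V) (e.hom.c.app (op U) s) = σ (op j) := by
    rw [hs, ← hl, ← ConcreteCategory.comp_apply L.inv]
    erw [PresheafedSpace.colimitPresheafObjIsoComponentwiseLimit_inv_ι_app]
    rfl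
  exact ⟨s, key .left, key .right⟩

/-- A commutative square of locally ringed spaces exhibiting `P` as obtained from the schemes `X`
and `Y` by identifying the images of `Z`: the topology and the structure sheaf of `P` are
determined by those of `X` and `Y`. -/
structure IsGluing {Z X Y : Scheme.{u}} {P : LocallyRingedSpace.{u}} (f : Z ⟶ X) (g : Z ⟶ Y)
    (inl : X.toLocallyRingedSpace ⟶ P) (inr : Y.toLocallyRingedSpace ⟶ P) : Prop where
  w : f.toLRSHom ≫ inl = g.toLRSHom ≫ inr
  exists_rep (p : P) : (∃ x : X, inl.base x = p) ∨ ∃ y : Y, inr.base y = p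
  exists_opens (U : X.Opens) (V : Y.Opens) (h : f ⁻¹ᵁ U = g ⁻¹ᵁ V) :
    ∃ O : Opens P, (Opens.map inl.base).obj O = U ∧ (Opens.map inr.base).obj O = V
  section_ext (O : Opens P) (s t : P.presheaf.obj (op O))
    (hl : inl.c.app (op O) s = inl.c.app (op O) t)
    (hr : inr.c.app (op O) s = inr.c.app (op O) t) : s = t
  exists_section (O : Opens P) (T : Z.Opens)
    (e₁ : T = f ⁻¹ᵁ (Opens.map inl.base).obj O) (e₂ : T = g ⁻¹ᵁ (Opens.map inr.base).obj O)
    (a : Γ(X, (Opens.map inl.base).obj O)) (b : Γ(Y, (Opens.map inr.base).obj O))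
    (hab : f.appLE _ T e₁.le a = g.appLE _ T e₂.le b) :
    ∃ s : P.presheaf.obj (op O), inl.c.app (op O) s = a ∧ inr.c.app (op O) s = b

theorem _root_.TopCat.exists_opens_of_isPushout_s2 {Z X Y P : TopCat.{u}} {f : Z ⟶ X} {g : Z ⟶ Y}
    {inl : X ⟶ P} {inr : Y ⟶ P} (h : IsPushout f g inl inr) (U : Opens X) (V : Opens Y)
    (hUV : (Opens.map f).obj U = (Opens.map g).obj V) :
    ∃ O : Opens P, (Opens.map inl).obj O = U ∧ (Opens.map inr).obj O = V := by
  let ind {T : TopCat.{u}} (W : Opens T) : T ⟶ TopCat.of (ULift.{u} Prop) :=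
    TopCat.ofHom ⟨fun t ↦ ⟨t ∈ W⟩, continuous_uliftUp.comp (isOpen_iff_continuous_mem.mp W.2)⟩
  have w : f ≫ ind U = g ≫ ind V := by
    ext z
    exact SetLike.ext_iff.mp hUV z
  let d := h.desc _ _ w
  have hO : IsOpen {p : P | (d p).down} :=
    isOpen_iff_continuous_mem.mpr (continuous_uliftDown.comp d.hom.continuous)
  refine ⟨⟨_, hO⟩, ?_, ?_⟩
  · ext x
    exact iff_of_eq (congrArg ULift.down (ConcreteCategory.congr_hom (h.inl_desc _ _ w) x))
  · ext y
    exact iff_of_eq (congrArg ULift.down (ConcreteCategory.congr_hom (h.inr_desc _ _ w) y))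

theorem IsGluing.of_isPushout {Z X Y : Scheme.{u}} {P : LocallyRingedSpace.{u}} {f : Z ⟶ X}
    {g : Z ⟶ Y} {inl : X.toLocallyRingedSpace ⟶ P} {inr : Y.toLocallyRingedSpace ⟶ P}
    (h : IsPushout f.toLRSHom g.toLRSHom inl inr) : IsGluing f g inl inr := by
  have h₁ := h.map LocallyRingedSpace.forgetToSheafedSpace
  have h₂ := h₁.map SheafedSpace.forgetToPresheafedSpace
  have h₃ := h₂.map (PresheafedSpace.forget _)
  refine ⟨h.w, fun p ↦ ?_, TopCat.exists_opens_of_isPushout_s2 h₃,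
    presheafedSpace_section_ext_of_isPushout h₂,
    presheafedSpace_exists_section_of_isPushout h₂⟩
  obtain ⟨j, x, hx⟩ := SheafedSpace.isColimit_exists_rep _ h₁.isColimit p
  match j with
  | .zero => exact .inl ⟨f x, hx⟩
  | .left => exact .inl ⟨x, hx⟩
  | .right => exact .inr ⟨x, hx⟩

namespace IsGluing

variable {Z X Y : Scheme.{u}} {P : LocallyRingedSpace.{u}} {f : Z ⟶ X} {g : Z ⟶ Y}
  {inl : X.toLocallyRingedSpace ⟶ P} {inr : Y.toLocallyRingedSpace ⟶ P}

theorem symm (h : IsGluing f g inl inr) : IsGluing g f inr inl where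
  w := h.w.symm
  exists_rep p := (h.exists_rep p).symm
  exists_opens U V e := (h.exists_opens V U e.symm).imp fun _ ↦ And.symm
  section_ext O s t hl hr := h.section_ext O s t hr hl
  exists_section O T e₁ e₂ a b hab :=
    (h.exists_section O T e₂ e₁ b a hab.symm).imp fun _ ↦ And.symm

theorem map_app_congr {k k' : Z.toLocallyRingedSpace ⟶ P} (e : k = k') (O : Opens P)
    (s : P.presheaf.obj (op O)) (T : Z.Opens) (h₁ : T ≤ (Opens.map k.base).obj O)
    (h₂ : T ≤ (Opens.map k'.base).obj O) :
    Z.presheaf.map (homOfLE h₁).op (k.c.app (op O) s) =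
      Z.presheaf.map (homOfLE h₂).op (k'.c.app (op O) s) := by
  subst e; rfl

variable (h : IsGluing f g inl inr)
include h

theorem inl_apply (z : Z) : inl.base (f z) = inr.base (g z) :=
  congr($(h.w).base z)

theorem preimage_eq (O : Opens P) :
    f ⁻¹ᵁ (Opens.map inl.base).obj O = g ⁻¹ᵁ (Opens.map inr.base).obj O := by
  ext z
  exact iff_of_eq (congrArg (· ∈ O) (h.inl_apply z))

theorem appLE_eq (O : Opens P) (s : P.presheaf.obj (op O)) (T : Z.Opens)
    (h₁ : T ≤ f ⁻¹ᵁ (Opens.map inl.base).obj O) (h₂ : T ≤ g ⁻¹ᵁ (Opens.map inr.base).obj O) :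
    f.appLE _ T h₁ (inl.c.app (op O) s) = g.appLE _ T h₂ (inr.c.app (op O) s) :=
  map_app_congr h.w O s T h₁ h₂

end IsGluing

theorem _root_.IsLocalization.Away.bijective_of_comp_eq {R S Q : Type*} [CommRing R] [CommRing S]
    [CommRing Q] [Algebra R S] (r : R) [IsLocalization.Away r S] (φ : R →+* Q)
    (isUnit : IsUnit (φ r)) (eq_zero : ∀ s, φ s = 0 → ∃ n : ℕ, r ^ n * s = 0)
    (exists_eq : ∀ t, ∃ (n : ℕ) (s : R), φ s = φ r ^ n * t) (c : S →+* Q)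
    (hc : c.comp (algebraMap R S) = φ) : Function.Bijective c := by
  algebraize [φ]
  have : IsLocalization (Submonoid.powers r) Q := by
    refine (isLocalization_iff _ _).mpr ⟨?_, fun t ↦ ?_, fun {x y} e ↦ ?_⟩
    · rintro ⟨_, n, rfl⟩
      change IsUnit (φ (r ^ n))
      rw [map_pow]
      exact isUnit.pow n
    · obtain ⟨n, s, hs⟩ := exists_eq t
      refine ⟨⟨s, ⟨r ^ n, n, rfl⟩⟩, ?_⟩
      change t * φ (r ^ n) = φ s
      rw [hs, map_pow, mul_comm]
    · obtain ⟨n, hn⟩ := eq_zero (x - y) (by rw [map_sub]; exact sub_eq_zero.mpr e)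
      exact ⟨⟨r ^ n, n, rfl⟩, sub_eq_zero.mp (by rw [← mul_sub]; exact hn)⟩
  exact IsLocalization.bijective (Submonoid.powers r) c hc

/-- A locally ringed space whose global sections behave like those of an affine scheme is affine. -/
theorem LocallyRingedSpace.isIso_toΓSpec (Q : LocallyRingedSpace.{u})
    (eq_zero : ∀ (r s : Q.presheaf.obj (op ⊤)) (D : Opens Q), D = Q.toRingedSpace.basicOpen r →
      Q.presheaf.map (homOfLE (le_top : D ≤ ⊤)).op s = 0 → ∃ n : ℕ, r ^ n * s = 0)
    (exists_eq : ∀ (r : Q.presheaf.obj (op ⊤)) (D : Opens Q), D = Q.toRingedSpace.basicOpen r →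
      ∀ t : Q.presheaf.obj (op D), ∃ (n : ℕ) (s : Q.presheaf.obj (op ⊤)),
      Q.presheaf.map (homOfLE (le_top : D ≤ ⊤)).op s =
        Q.presheaf.map (homOfLE (le_top : D ≤ ⊤)).op r ^ n * t)
    (eq_of_basicOpen : ∀ x y : Q, (∀ r : Q.presheaf.obj (op ⊤),
      x ∈ Q.toRingedSpace.basicOpen r ↔ y ∈ Q.toRingedSpace.basicOpen r) → x = y)
    (exists_basicOpen : ∀ (O : Opens Q) (x : Q), x ∈ O →
      ∃ r : Q.presheaf.obj (op ⊤), x ∈ Q.toRingedSpace.basicOpen r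
          ∧ Q.toRingedSpace.basicOpen r ≤ O)
    (exists_point : ∀ p : Ideal (Q.presheaf.obj (op ⊤)), p.IsPrime →
      ∃ x : Q, ∀ r, x ∈ Q.toRingedSpace.basicOpen r ↔ r ∉ p) :
    IsIso Q.toΓSpec := by
  have mem (x : Q) (r : Q.presheaf.obj (op ⊤)) :
      x ∈ Q.toRingedSpace.basicOpen r ↔ r ∉ (Q.toΓSpecFun x).asIdeal :=
    (Set.ext_iff.mp (Q.toΓSpec_preimage_basicOpen_eq r) x).symm
  have ind : Topology.IsInducing Q.toΓSpecFun := by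
    refine ⟨le_antisymm Q.toΓSpec_continuous.le_induced fun O hO ↦ ?_⟩
    refine (@isOpen_iff_forall_mem_open _ (_) _).mpr fun x hx ↦ ?_
    obtain ⟨r, hr, hrO⟩ := exists_basicOpen ⟨O, hO⟩ x hx
    refine ⟨_, hrO, ?_, hr⟩
    exact ⟨_, (PrimeSpectrum.basicOpen r).2, Q.toΓSpec_preimage_basicOpen_eq r⟩
  have bij : Function.Bijective Q.toΓSpecFun := by
    refine ⟨fun x y e ↦ eq_of_basicOpen x y fun r ↦ by rw [mem, mem, e], fun p ↦ ?_⟩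
    obtain ⟨x, hx⟩ := exists_point p.asIdeal p.2
    refine ⟨x, PrimeSpectrum.ext (Ideal.ext fun r ↦ not_iff_not.mp ?_)⟩
    exact (mem x r).symm.trans (hx r)
  have hb : IsIso Q.toΓSpecBase :=
    (TopCat.isIso_iff_isHomeomorph _).mpr
      ((Equiv.ofBijective _ bij).toHomeomorphOfIsInducing ind).isHomeomorph
  have hb' : IsIso Q.toΓSpecSheafedSpace.hom.base := hb
  let φ : Spec.structureSheaf (Q.presheaf.obj (op ⊤)) ⟶
      (TopCat.Sheaf.pushforward _ Q.toΓSpecBase).obj Q.𝒪 :=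
    ⟨Q.toΓSpecSheafedSpace.hom.c⟩
  have hφ : IsIso φ := by
    refine TopCat.Sheaf.isIso_iff_isIso_basis PrimeSpectrum.isBasis_basic_opens fun r ↦ ?_
    have e := Q.toΓSpecMapBasicOpen_eq r
    refine (ConcreteCategory.isIso_iff_bijective _).mpr ?_
    exact @IsLocalization.Away.bijective_of_comp_eq _ _ _ _ _ _
      (StructureSheaf.openAlgebra (LocallyRingedSpace.Γ.obj (op Q))
          (op (PrimeSpectrum.basicOpen r)))
      r (StructureSheaf.IsLocalization.to_basicOpen _ r)
      (Q.toToΓSpecMapBasicOpen r).hom (Q.isUnit_res_toΓSpecMapBasicOpen r)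
      (fun s hs ↦ eq_zero r s _ e hs) (exists_eq r _ e) _
      (congr($(Q.toΓSpecSheafedSpace_app_spec r).hom))
  have hc : IsIso Q.toΓSpecSheafedSpace.hom.c :=
    (ObjectProperty.isIso_hom_iff φ).mpr hφ
  have h₁ : IsIso (SheafedSpace.forgetToPresheafedSpace.map Q.toΓSpecSheafedSpace) :=
    PresheafedSpace.isIso_of_components Q.toΓSpecSheafedSpace.hom
  have h₂ : IsIso (LocallyRingedSpace.forgetToSheafedSpace.map Q.toΓSpec) :=
    isIso_of_reflects_iso Q.toΓSpecSheafedSpace SheafedSpace.forgetToPresheafedSpace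
  exact isIso_of_reflects_iso _ LocallyRingedSpace.forgetToSheafedSpace

theorem IsAffineOpen.exists_pow_mul_eq_zero_s2 {X : Scheme.{u}} {U D : X.Opens} (hU : IsAffineOpen U)
    (i : D ≤ U) (r s : Γ(X, U)) (hD : D = X.basicOpen r)
    (hs : X.presheaf.map (homOfLE i).op s = 0) : ∃ n : ℕ, r ^ n * s = 0 := by
  subst hD
  exact exists_pow_mul_eq_zero_of_res_basicOpen_eq_zero_of_isCompact X hU.isCompact s r hs

theorem IsAffineOpen.exists_eq_pow_mul {X : Scheme.{u}} {U D : X.Opens} (hU : IsAffineOpen U)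
    (i : D ≤ U) (r : Γ(X, U)) (hD : D = X.basicOpen r) (t : Γ(X, D)) :
    ∃ (n : ℕ) (s : Γ(X, U)), X.presheaf.map (homOfLE i).op s =
      X.presheaf.map (homOfLE i).op r ^ n * t := by
  subst hD
  exact exists_eq_pow_mul_of_isAffineOpen X U hU r t

theorem app_map_of_le {X : Scheme.{u}} {P : LocallyRingedSpace.{u}} (k : X.toLocallyRingedSpace ⟶ P)
    {D O : Opens P} (i : D ≤ O) (s : P.presheaf.obj (op O)) :
    k.c.app (op D) (P.presheaf.map (homOfLE i).op s) =
      X.presheaf.map (homOfLE (show (Opens.map k.base).obj D ≤ (Opens.map k.base).obj O from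
        fun _ hx ↦ i hx)).op (k.c.app (op O) s) :=
  ConcreteCategory.congr_hom (k.c.naturality (homOfLE i).op) s

namespace IsGluing

variable {Z X Y : Scheme.{u}} {P : LocallyRingedSpace.{u}} {f : Z ⟶ X} {g : Z ⟶ Y}
  {inl : X.toLocallyRingedSpace ⟶ P} {inr : Y.toLocallyRingedSpace ⟶ P} (h : IsGluing f g inl inr)
include h

theorem exists_inl_app_eq [IsClosedImmersion g] {O : Opens P}
    (hV : IsAffineOpen ((Opens.map inr.base).obj O)) (a : Γ(X, (Opens.map inl.base).obj O)) :
    ∃ s : P.presheaf.obj (op O), inl.c.app (op O) s = a := by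
  obtain ⟨b, hb⟩ := g.app_surjective _ hV (f.appLE _ _ (h.preimage_eq O).ge a)
  rw [g.app_eq_appLE] at hb
  exact (h.exists_section O _ (h.preimage_eq O).symm rfl a b hb.symm).imp fun _ ↦ And.left

theorem exists_pow_mul_eq_zero_s2 {O D : Opens P} (hU : IsAffineOpen ((Opens.map inl.base).obj O))
    (hV : IsAffineOpen ((Opens.map inr.base).obj O)) (i : D ≤ O) (r s : P.presheaf.obj (op O))
    (hD : D = P.toRingedSpace.basicOpen r) (hs : P.presheaf.map (homOfLE i).op s = 0) :
    ∃ n : ℕ, r ^ n * s = 0 := by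
  have il : (Opens.map inl.base).obj D ≤ (Opens.map inl.base).obj O := fun _ hx ↦ i hx
  have ir : (Opens.map inr.base).obj D ≤ (Opens.map inr.base).obj O := fun _ hx ↦ i hx
  obtain ⟨n, hn⟩ := hU.exists_pow_mul_eq_zero_s2 il (inl.c.app (op O) r) (inl.c.app (op O) s)
    (by rw [hD]; exact LocallyRingedSpace.preimage_basicOpen inl r)
    ((app_map_of_le inl i s).symm.trans (by rw [hs, map_zero]))
  obtain ⟨m, hm⟩ := hV.exists_pow_mul_eq_zero_s2 ir (inr.c.app (op O) r) (inr.c.app (op O) s)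
    (by rw [hD]; exact LocallyRingedSpace.preimage_basicOpen inr r)
    ((app_map_of_le inr i s).symm.trans (by rw [hs, map_zero]))
  refine ⟨n + m, h.section_ext O _ _ ?_ ?_⟩
  · rw [map_mul, map_pow, map_zero, pow_add, mul_right_comm]
    erw [hn]
    rw [zero_mul]
  · rw [map_mul, map_pow, map_zero, pow_add, mul_assoc]
    erw [hm]
    rw [mul_zero]

theorem exists_eq_pow_mul [IsClosedImmersion f] {O D : Opens P}
    (hU : IsAffineOpen ((Opens.map inl.base).obj O))
    (hV : IsAffineOpen ((Opens.map inr.base).obj O)) (i : D ≤ O) (r : P.presheaf.obj (op O))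
    (hD : D = P.toRingedSpace.basicOpen r) (t : P.presheaf.obj (op D)) :
    ∃ (n : ℕ) (s : P.presheaf.obj (op O)),
      P.presheaf.map (homOfLE i).op s = P.presheaf.map (homOfLE i).op r ^ n * t := by
  have il : (Opens.map inl.base).obj D ≤ (Opens.map inl.base).obj O := fun _ hx ↦ i hx
  have ir : (Opens.map inr.base).obj D ≤ (Opens.map inr.base).obj O := fun _ hx ↦ i hx
  have hDl : (Opens.map inl.base).obj D = X.basicOpen (U := (Opens.map inl.base).obj O)
      (inl.c.app (op O) r) := by
    rw [hD]; exact LocallyRingedSpace.preimage_basicOpen inl r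
  have hDr : (Opens.map inr.base).obj D = Y.basicOpen (U := (Opens.map inr.base).obj O)
      (inr.c.app (op O) r) := by
    rw [hD]; exact LocallyRingedSpace.preimage_basicOpen inr r
  have e := h.preimage_eq O
  have eD := h.preimage_eq D
  let ρ : P.presheaf.obj (op O) →+* P.presheaf.obj (op D) := (P.presheaf.map (homOfLE i).op).hom
  let L : P.presheaf.obj (op O) →+* Γ(X, (Opens.map inl.base).obj O) := (inl.c.app (op O)).hom
  let R : P.presheaf.obj (op O) →+* Γ(Y, (Opens.map inr.base).obj O) := (inr.c.app (op O)).hom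
  let L' : P.presheaf.obj (op D) →+* Γ(X, (Opens.map inl.base).obj D) := (inl.c.app (op D)).hom
  let R' : P.presheaf.obj (op D) →+* Γ(Y, (Opens.map inr.base).obj D) := (inr.c.app (op D)).hom
  let ρl := (X.presheaf.map (homOfLE il).op).hom
  let ρr := (Y.presheaf.map (homOfLE ir).op).hom
  have hL (s) : L' (ρ s) = ρl (L s) := app_map_of_le inl i s
  have hR (s) : R' (ρ s) = ρr (R s) := app_map_of_le inr i s
  let F := (f.appLE _ (f ⁻¹ᵁ (Opens.map inl.base).obj O) le_rfl).hom
  let G := (g.appLE _ (f ⁻¹ᵁ (Opens.map inl.base).obj O) e.le).hom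
  let F' := (f.appLE _ (f ⁻¹ᵁ (Opens.map inl.base).obj D) le_rfl).hom
  let G' := (g.appLE _ (f ⁻¹ᵁ (Opens.map inl.base).obj D) eD.le).hom
  have iZ : f ⁻¹ᵁ (Opens.map inl.base).obj D ≤ f ⁻¹ᵁ (Opens.map inl.base).obj O := fun _ hz ↦ il hz
  let ρZ := (Z.presheaf.map (homOfLE iZ).op).hom
  have hF (a) : ρZ (F a) = F' (ρl a) :=
    (ConcreteCategory.congr_hom (f.appLE_map _ (homOfLE iZ).op) a).trans
      (ConcreteCategory.congr_hom (f.map_appLE _ (homOfLE il).op) a).symm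
  have hG (a) : ρZ (G a) = G' (ρr a) :=
    (ConcreteCategory.congr_hom (g.appLE_map _ (homOfLE iZ).op) a).trans
      (ConcreteCategory.congr_hom (g.map_appLE _ (homOfLE ir).op) a).symm
  have hFG (s) : F (L s) = G (R s) := h.appLE_eq O s _ _ _
  have hFG' (s) : F' (L' s) = G' (R' s) := h.appLE_eq D s _ _ _
  obtain ⟨n, a, ha : ρl a = ρl (L r) ^ n * L' t⟩ := hU.exists_eq_pow_mul il (L r) hDl (L' t)
  obtain ⟨m, b, hb : ρr b = ρr (R r) ^ m * R' t⟩ := hV.exists_eq_pow_mul ir (R r) hDr (R' t)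
  obtain ⟨k, hk⟩ := (hU.preimage f).exists_pow_mul_eq_zero_s2 iZ (F (L r))
    (F (L r ^ m * a) - G (R r ^ n * b))
    (by
      simp only [F, ← f.app_eq_appLE]
      exact congr(f ⁻¹ᵁ $hDl).trans (f.preimage_basicOpen _))
    (by
      change ρZ _ = 0
      rw [map_sub, hF, hG, sub_eq_zero, map_mul ρl, map_mul ρr, ha, hb, map_pow ρl, map_pow ρr,
        ← hL, ← hR, ← mul_assoc, ← mul_assoc, ← pow_add, ← pow_add, add_comm n, map_mul F',
        map_mul G', map_pow F', map_pow G', hFG', hFG'])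
  obtain ⟨s, hsl : L s = _, hsr : R s = _⟩ := h.exists_section O _ rfl e
    (L r ^ (k + m) * a) (R r ^ (k + n) * b) (by
      change F _ = G _
      rw [pow_add, pow_add, mul_assoc, mul_assoc, map_mul F, map_mul G, map_pow F, map_pow G, ← hFG,
        ← sub_eq_zero, ← mul_sub, hk])
  refine ⟨k + m + n, s, h.section_ext D _ _ ?_ ?_⟩
  · change L' (ρ s) = L' (ρ r ^ (k + m + n) * t)
    rw [hL, hsl, map_mul, map_mul, map_pow, map_pow, ha, hL]
    ring
  · change R' (ρ s) = R' (ρ r ^ (k + m + n) * t)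
    rw [hR, hsr, map_mul, map_mul, map_pow, map_pow, hb, hR]
    ring

end IsGluing

theorem IsAffineOpen.eq_of_mem_basicOpen_iff {X : Scheme.{u}} {U : X.Opens} (hU : IsAffineOpen U)
    {x y : X} (hx : x ∈ U) (hy : y ∈ U) (h : ∀ a : Γ(X, U), x ∈ X.basicOpen a ↔ y ∈ X.basicOpen a) :
    x = y := by
  refine Inseparable.eq (inseparable_iff_forall_isOpen.mpr fun W hW ↦ ⟨fun hxW ↦ ?_, fun hyW ↦ ?_⟩)
  · obtain ⟨a, ha, hxa⟩ := hU.exists_basicOpen_le (V := ⟨W, hW⟩) ⟨x, hxW⟩ hx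
    exact ha ((h a).mp hxa)
  · obtain ⟨a, ha, hya⟩ := hU.exists_basicOpen_le (V := ⟨W, hW⟩) ⟨y, hyW⟩ hy
    exact ha ((h a).mpr hya)

theorem IsAffineOpen.exists_mem_basicOpen_iff {X : Scheme.{u}} {U : X.Opens} (hU : IsAffineOpen U)
    (p : Ideal Γ(X, U)) [hp : p.IsPrime] : ∃ x ∈ U, ∀ a : Γ(X, U), x ∈ X.basicOpen a ↔ a ∉ p := by
  refine ⟨hU.fromSpec ⟨p, hp⟩, hU.opensRange_fromSpec.le ⟨_, rfl⟩, fun a ↦ ?_⟩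
  exact SetLike.ext_iff.mp (hU.fromSpec_preimage_basicOpen a) ⟨p, hp⟩

theorem IsAffineOpen.exists_pow_eq_zero_of_basicOpen_eq_bot {X : Scheme.{u}} {U : X.Opens}
    (hU : IsAffineOpen U) (a : Γ(X, U)) (ha : X.basicOpen a = ⊥) : ∃ n : ℕ, a ^ n = 0 := by
  obtain ⟨n, hn⟩ := hU.exists_pow_mul_eq_zero_s2 bot_le a 1 ha.symm (Subsingleton.elim _ _)
  exact ⟨n, by rwa [mul_one] at hn⟩

namespace IsGluing

variable {Z X Y : Scheme.{u}} {P : LocallyRingedSpace.{u}} {f : Z ⟶ X} {g : Z ⟶ Y}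
  {inl : X.toLocallyRingedSpace ⟶ P} {inr : Y.toLocallyRingedSpace ⟶ P}

theorem mem_basicOpen_iff (k : X.toLocallyRingedSpace ⟶ P) {O : Opens P}
    (r : P.presheaf.obj (op O)) (x : X) : k.base x ∈ P.toRingedSpace.basicOpen r ↔
      x ∈ X.basicOpen (U := (Opens.map k.base).obj O) (k.c.app (op O) r) :=
  SetLike.ext_iff.mp (LocallyRingedSpace.preimage_basicOpen k r) x

theorem notMem_basicOpen_of_app_eq_zero (k : X.toLocallyRingedSpace ⟶ P) {O : Opens P}
    (r : P.presheaf.obj (op O)) (hr : k.c.app (op O) r = 0) (x : X) :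
    k.base x ∉ P.toRingedSpace.basicOpen r := by
  rw [mem_basicOpen_iff, hr]
  intro hx
  erw [X.basicOpen_zero] at hx
  exact hx

variable (h : IsGluing f g inl inr)
include h

theorem exists_inr_app_eq_zero [IsClosedImmersion f] {O : Opens P}
    (hU : IsAffineOpen ((Opens.map inl.base).obj O)) (W : X.Opens) (x : X) (hx : inl.base x ∈ O)
    (hxW : x ∈ W) (hxf : x ∉ Set.range f) : ∃ r : P.presheaf.obj (op O),
      inl.base x ∈ P.toRingedSpace.basicOpen r ∧
      (Opens.map inl.base).obj (P.toRingedSpace.basicOpen r) ≤ W ∧ inr.c.app (op O) r = 0 := by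
  let C : X.Opens := ⟨(Set.range f)ᶜ, f.isClosedEmbedding.isClosed_range.isOpen_compl⟩
  obtain ⟨a, ha, hxa⟩ := hU.exists_basicOpen_le (V := W ⊓ C) ⟨x, hxW, hxf⟩ hx
  obtain ⟨n, hn⟩ := (hU.preimage f).exists_pow_eq_zero_of_basicOpen_eq_bot (f.app _ a) (by
    rw [← f.preimage_basicOpen]
    exact eq_bot_iff.mpr fun z hz ↦ (ha hz).2 ⟨z, rfl⟩)
  obtain ⟨r, hl, hr⟩ := h.exists_section O _ rfl (h.preimage_eq O) (a ^ (n + 1)) 0 (by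
    rw [← f.app_eq_appLE, map_zero, map_pow, pow_succ, hn, zero_mul])
  have e (y : X) : inl.base y ∈ P.toRingedSpace.basicOpen r ↔ y ∈ X.basicOpen a := by
    rw [mem_basicOpen_iff, hl]
    exact SetLike.ext_iff.mp (X.basicOpen_pow _ n.succ_pos) y
  exact ⟨r, (e x).mpr hxa, fun y hy ↦ (ha ((e y).mp hy)).1, hr⟩

section

variable {O : Opens P}
  (hU : IsAffineOpen ((Opens.map inl.base).obj O)) (hV : IsAffineOpen ((Opens.map inr.base).obj O))
include hU hV

theorem eq_of_mem_basicOpen_iff_left [IsClosedImmersion g] {x y : X} (hx : inl.base x ∈ O)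
    (hy : inl.base y ∈ O)
    (H : ∀ r : P.presheaf.obj (op O), inl.base x ∈ P.toRingedSpace.basicOpen r ↔
      inl.base y ∈ P.toRingedSpace.basicOpen r) : inl.base x = inl.base y := by
  refine congrArg _ (hU.eq_of_mem_basicOpen_iff hx hy fun a ↦ ?_)
  obtain ⟨r, rfl⟩ := h.exists_inl_app_eq hV a
  rw [← mem_basicOpen_iff, ← mem_basicOpen_iff, H]

theorem eq_of_mem_basicOpen_iff_mixed [IsClosedImmersion f] {x : X} {y : Y} (hx : inl.base x ∈ O)
    (hy : inr.base y ∈ O)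
    (H : ∀ r : P.presheaf.obj (op O), inl.base x ∈ P.toRingedSpace.basicOpen r ↔
      inr.base y ∈ P.toRingedSpace.basicOpen r) : inl.base x = inr.base y := by
  by_cases hxf : x ∈ Set.range f
  · obtain ⟨z, rfl⟩ := hxf
    rw [h.inl_apply] at hx H ⊢
    exact h.symm.eq_of_mem_basicOpen_iff_left hV hU hx hy H
  · obtain ⟨r, hr, -, hr₀⟩ := h.exists_inr_app_eq_zero hU ⊤ x hx trivial hxf
    exact absurd ((H r).mp hr) (notMem_basicOpen_of_app_eq_zero inr r hr₀ y)

theorem eq_of_mem_basicOpen_iff [IsClosedImmersion f] [IsClosedImmersion g] {p q : P} (hp : p ∈ O)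
    (hq : q ∈ O)
    (H : ∀ r : P.presheaf.obj (op O), p ∈ P.toRingedSpace.basicOpen r ↔
      q ∈ P.toRingedSpace.basicOpen r) : p = q := by
  obtain ⟨x, rfl⟩ | ⟨x, rfl⟩ := h.exists_rep p <;> obtain ⟨y, rfl⟩ | ⟨y, rfl⟩ := h.exists_rep q
  · exact h.eq_of_mem_basicOpen_iff_left hU hV hp hq H
  · exact h.eq_of_mem_basicOpen_iff_mixed hU hV hp hq H
  · exact h.symm.eq_of_mem_basicOpen_iff_mixed hV hU hp hq H
  · exact h.symm.eq_of_mem_basicOpen_iff_left hV hU hp hq H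

theorem exists_basicOpen_le_left [IsClosedImmersion g] {O' : Opens P} {x : X} (hx : inl.base x ∈ O)
    (hx' : inl.base x ∈ O') : ∃ r : P.presheaf.obj (op O),
      inl.base x ∈ P.toRingedSpace.basicOpen r ∧
      (Opens.map inl.base).obj (P.toRingedSpace.basicOpen r) ≤ (Opens.map inl.base).obj O' := by
  obtain ⟨a, ha, hxa⟩ := hU.exists_basicOpen_le (V := (Opens.map inl.base).obj O') ⟨x, hx'⟩ hx
  obtain ⟨r, rfl⟩ := h.exists_inl_app_eq hV a
  exact ⟨r, (mem_basicOpen_iff _ _ _).mpr hxa, fun y hy ↦ ha ((mem_basicOpen_iff _ _ _).mp hy)⟩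

theorem exists_basicOpen_le_aux [IsClosedImmersion f] [IsClosedImmersion g] {O' : Opens P} {x : X}
    (hx : inl.base x ∈ O)
    (hx' : inl.base x ∈ O') : ∃ r : P.presheaf.obj (op O),
      inl.base x ∈ P.toRingedSpace.basicOpen r ∧ P.toRingedSpace.basicOpen r ≤ O' := by
  obtain ⟨r₁, hr₁, hr₁'⟩ := h.exists_basicOpen_le_left hU hV hx hx'
  obtain ⟨r₂, hr₂, hr₂'⟩ : ∃ r : P.presheaf.obj (op O),
      inl.base x ∈ P.toRingedSpace.basicOpen r ∧
      (Opens.map inr.base).obj (P.toRingedSpace.basicOpen r) ≤ (Opens.map inr.base).obj O' := by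
    by_cases hxf : x ∈ Set.range f
    · obtain ⟨z, rfl⟩ := hxf
      rw [h.inl_apply] at hx hx' ⊢
      exact h.symm.exists_basicOpen_le_left hV hU hx hx'
    · obtain ⟨r, hr, -, hr₀⟩ := h.exists_inr_app_eq_zero hU ⊤ x hx trivial hxf
      exact ⟨r, hr, fun y hy ↦ absurd hy (notMem_basicOpen_of_app_eq_zero inr r hr₀ y)⟩
  refine ⟨r₁ * r₂, ?_, fun p hp ↦ ?_⟩
  · rw [P.toRingedSpace.basicOpen_mul]
    exact ⟨hr₁, hr₂⟩
  · rw [P.toRingedSpace.basicOpen_mul] at hp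
    obtain ⟨y, rfl⟩ | ⟨y, rfl⟩ := h.exists_rep p
    · exact hr₁' hp.1
    · exact hr₂' hp.2

theorem exists_basicOpen_le [IsClosedImmersion f] [IsClosedImmersion g] {O' : Opens P} {p : P}
    (hp : p ∈ O)
    (hp' : p ∈ O') : ∃ r : P.presheaf.obj (op O),
      p ∈ P.toRingedSpace.basicOpen r ∧ P.toRingedSpace.basicOpen r ≤ O' := by
  obtain ⟨x, rfl⟩ | ⟨x, rfl⟩ := h.exists_rep p
  · exact h.exists_basicOpen_le_aux hU hV hp hp'
  · exact h.symm.exists_basicOpen_le_aux hV hU hp hp'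

theorem exists_mem_basicOpen_iff_of_ker_le [IsClosedImmersion g]
    (p : Ideal (P.presheaf.obj (op O))) [p.IsPrime]
    (hp : ∀ s, inl.c.app (op O) s = 0 → s ∈ p) :
    ∃ q ∈ O, ∀ r : P.presheaf.obj (op O), q ∈ P.toRingedSpace.basicOpen r ↔ r ∉ p := by
  let L : P.presheaf.obj (op O) →+* Γ(X, (Opens.map inl.base).obj O) := (inl.c.app (op O)).hom
  have hL : Function.Surjective L := h.exists_inl_app_eq hV
  have hker : RingHom.ker L ≤ p := hp
  have := Ideal.map_isPrime_of_surjective hL hker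
  obtain ⟨x, hx, H⟩ := hU.exists_mem_basicOpen_iff (p.map L)
  refine ⟨inl.base x, hx, fun r ↦ ?_⟩
  rw [mem_basicOpen_iff]
  refine (H _).trans (not_congr ?_)
  change r ∈ (p.map L).comap L ↔ r ∈ p
  rw [Ideal.comap_map_of_surjective' L hL, sup_eq_left.mpr hker]

theorem exists_mem_basicOpen_iff [IsClosedImmersion f] [IsClosedImmersion g]
    (p : Ideal (P.presheaf.obj (op O))) [hp : p.IsPrime] :
    ∃ q ∈ O, ∀ r : P.presheaf.obj (op O), q ∈ P.toRingedSpace.basicOpen r ↔ r ∉ p := by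
  by_cases hker : ∀ s, inl.c.app (op O) s = 0 → s ∈ p
  · exact h.exists_mem_basicOpen_iff_of_ker_le hU hV p hker
  · push Not at hker
    obtain ⟨s, hs, hsp⟩ := hker
    refine h.symm.exists_mem_basicOpen_iff_of_ker_le hV hU p fun t ht ↦ ?_
    have hst : s * t = 0 := h.section_ext O _ _ (by rw [map_mul, hs, zero_mul, map_zero])
      (by rw [map_mul, ht, mul_zero, map_zero])
    exact (hp.mem_or_mem (hst ▸ p.zero_mem)).resolve_left hsp

end

end IsGluing

theorem LocallyRingedSpace.mem_basicOpen_restrict (P : LocallyRingedSpace.{u}) (O : Opens P)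
    (r : P.presheaf.obj (op (O.isOpenEmbedding.functor.obj ⊤))) (x : O) :
    x ∈ (P.restrict O.isOpenEmbedding).toRingedSpace.basicOpen r ↔
      x.1 ∈ P.toRingedSpace.basicOpen r := by
  refine ((P.restrict O.isOpenEmbedding).toRingedSpace.mem_basicOpen (U := ⊤) r x trivial).trans
    (Iff.trans ?_ (P.toRingedSpace.mem_basicOpen r x.1 ⟨x, trivial, rfl⟩).symm)
  have e := P.restrictStalkIso_hom_eq_germ_apply O.isOpenEmbedding ⊤ x trivial r
  refine Iff.trans ?_ (iff_of_eq (congrArg IsUnit e))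
  exact (isUnit_map_iff (P.restrictStalkIso O.isOpenEmbedding x).hom.hom _).symm

theorem LocallyRingedSpace.eq_basicOpen_of_restrict (P : LocallyRingedSpace.{u}) (O : Opens P)
    (r : P.presheaf.obj (op (O.isOpenEmbedding.functor.obj ⊤)))
    (D : Opens (P.restrict O.isOpenEmbedding))
    (hD : D = (P.restrict O.isOpenEmbedding).toRingedSpace.basicOpen r) :
    O.isOpenEmbedding.functor.obj D = P.toRingedSpace.basicOpen r := by
  subst hD
  ext p
  constructor
  · rintro ⟨x, hx, rfl⟩
    exact (P.mem_basicOpen_restrict O r x).mp hx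
  · intro hp
    obtain ⟨x, -, rfl⟩ := P.toRingedSpace.basicOpen_le r hp
    exact ⟨x, (P.mem_basicOpen_restrict O r x).mpr hp, rfl⟩

theorem IsGluing.isIso_toΓSpec {Z X Y : Scheme.{u}} {P : LocallyRingedSpace.{u}} {f : Z ⟶ X}
    {g : Z ⟶ Y} {inl : X.toLocallyRingedSpace ⟶ P} {inr : Y.toLocallyRingedSpace ⟶ P}
    (h : IsGluing f g inl inr) [IsClosedImmersion f] [IsClosedImmersion g] {O : Opens P}
    (hU : IsAffineOpen ((Opens.map inl.base).obj O))
    (hV : IsAffineOpen ((Opens.map inr.base).obj O)) :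
    IsIso (P.restrict O.isOpenEmbedding).toΓSpec := by
  let Q := P.restrict O.isOpenEmbedding
  let F := O.isOpenEmbedding.functor
  have hO : F.obj ⊤ = O := by
    ext p
    exact ⟨fun ⟨x, _, hx⟩ ↦ hx ▸ x.2, fun hp ↦ ⟨⟨p, hp⟩, trivial, rfl⟩⟩
  have hU' : IsAffineOpen ((Opens.map inl.base).obj (F.obj ⊤)) := by rwa [hO]
  have hV' : IsAffineOpen ((Opens.map inr.base).obj (F.obj ⊤)) := by rwa [hO]
  refine Q.isIso_toΓSpec (fun r s D hD hs ↦ ?_) (fun r D hD t ↦ ?_) (fun x y H ↦ ?_)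
    (fun W x hx ↦ ?_) (fun p hp ↦ ?_)
  · exact h.exists_pow_mul_eq_zero_s2 hU' hV' (F.map (homOfLE le_top)).le r s
      (P.eq_basicOpen_of_restrict O r D hD) hs
  · exact h.exists_eq_pow_mul hU' hV' (F.map (homOfLE le_top)).le r
      (P.eq_basicOpen_of_restrict O r D hD) t
  · exact Subtype.ext (h.eq_of_mem_basicOpen_iff hU' hV' ⟨x, trivial, rfl⟩ ⟨y, trivial, rfl⟩
      fun r ↦ (P.mem_basicOpen_restrict O r x).symm.trans
        ((H r).trans (P.mem_basicOpen_restrict O r y)))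
  · obtain ⟨r, hr, hrW⟩ := h.exists_basicOpen_le hU' hV' (O' := F.obj W) (p := x.1)
      ⟨x, trivial, rfl⟩ ⟨x, hx, rfl⟩
    refine ⟨r, (P.mem_basicOpen_restrict O r x).mpr hr, fun y hy ↦ ?_⟩
    obtain ⟨y', hy', e⟩ := hrW ((P.mem_basicOpen_restrict O r y).mp hy)
    exact Subtype.ext e ▸ hy'
  · obtain ⟨q, hq, H⟩ := h.exists_mem_basicOpen_iff hU' hV' p (hp := hp)
    obtain ⟨x, -, rfl⟩ := hq
    exact ⟨x, fun r ↦ (P.mem_basicOpen_restrict O r x).trans (H r)⟩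

theorem Scheme.Hom.morphismRestrict_appTop_surjective {X Y : Scheme.{u}} (f : X ⟶ Y) (U : Y.Opens)
    (hf : Function.Surjective (f.app U)) : Function.Surjective (f ∣_ U).appTop := by
  have hf' : ∀ V, V = U → Function.Surjective (f.app V) := by
    rintro _ rfl
    exact hf
  rw [morphismRestrict_appTop]
  exact (ConcreteCategory.bijective_of_isIso
    (X.presheaf.map (eqToHom (image_morphismRestrict_preimage f U ⊤)).op)).2.comp
      (hf' _ U.ι_image_top)

theorem isClosedImmersion_of_forall_exists_isAffineOpen {X Y : Scheme.{u}} (f : X ⟶ Y)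
    (H : ∀ y : Y, ∃ U : Y.Opens, y ∈ U ∧ IsAffineOpen U ∧ IsAffineOpen (f ⁻¹ᵁ U) ∧
      Function.Surjective (f.app U)) : IsClosedImmersion f := by
  choose U hyU hU hfU hs using H
  refine @HasAffineProperty.of_iSup_eq_top _ _ IsClosedImmersion.hasAffineProperty _ _ _ _
      (fun y ↦ ⟨U y, hU y⟩)
    (top_le_iff.mp fun y _ ↦ Opens.mem_iSup.mpr ⟨y, hyU y⟩) fun y ↦
      ⟨hfU y, f.morphismRestrict_appTop_surjective (U y) (hs y)⟩

theorem Scheme.Hom.exists_isAffineOpen_preimage_eq {Z X Y : Scheme.{u}} (f : Z ⟶ X) (g : Z ⟶ Y)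
    [IsClosedImmersion f] [IsClosedImmersion g] (z : Z) :
    ∃ (U : X.Opens) (V : Y.Opens), IsAffineOpen U ∧ IsAffineOpen V ∧ f z ∈ U ∧
      f ⁻¹ᵁ U = g ⁻¹ᵁ V := by
  obtain ⟨V, hV, hzV, -⟩ := exists_isAffineOpen_mem_and_subset (X := Y) (x := g z) (U := ⊤) trivial
  obtain ⟨W, hW, hWV⟩ := f.isClosedEmbedding.isInducing.isOpen_iff.mp (g ⁻¹ᵁ V).2
  obtain ⟨U, hU, hzU, hUW⟩ := exists_isAffineOpen_mem_and_subset (X := X) (x := f z) (U := ⟨W, hW⟩)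
    (Set.ext_iff.mp hWV z |>.mpr hzV)
  have e : f ⁻¹ᵁ U ≤ g ⁻¹ᵁ V := fun y hy ↦ (Set.ext_iff.mp hWV y).mp (hUW hy)
  obtain ⟨W', hW', hWU'⟩ := g.isClosedEmbedding.isInducing.isOpen_iff.mp (f ⁻¹ᵁ U).2
  obtain ⟨b, hb, hzb⟩ := hV.exists_basicOpen_le (V := ⟨W', hW'⟩)
    ⟨g z, Set.ext_iff.mp hWU' z |>.mpr hzU⟩ hzV
  obtain ⟨c, hc⟩ := f.app_surjective U hU (g.appLE V (f ⁻¹ᵁ U) e b)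
  have hcb : f ⁻¹ᵁ X.basicOpen c = g ⁻¹ᵁ Y.basicOpen b := by
    rw [Scheme.preimage_basicOpen, hc, Scheme.basicOpen_appLE, inf_eq_right]
    exact fun y hy ↦ (Set.ext_iff.mp hWU' y).mp (hb hy)
  exact ⟨_, _, hU.basicOpen c, hV.basicOpen b, hcb.ge hzb, hcb⟩

namespace IsGluing

variable {Z X Y : Scheme.{u}} {P : LocallyRingedSpace.{u}} {f : Z ⟶ X}
    {g : Z ⟶ Y} {inl : X.toLocallyRingedSpace ⟶ P} {inr : Y.toLocallyRingedSpace ⟶ P}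
    (h : IsGluing f g inl inr) [IsClosedImmersion f] [IsClosedImmersion g]
include h

theorem exists_isAffineOpen_inl (x : X) : ∃ O : Opens P, inl.base x ∈ O ∧
    IsAffineOpen ((Opens.map inl.base).obj O) ∧ IsAffineOpen ((Opens.map inr.base).obj O) := by
  suffices ∃ (U : X.Opens) (V : Y.Opens), IsAffineOpen U ∧ IsAffineOpen V ∧ x ∈ U ∧
      f ⁻¹ᵁ U = g ⁻¹ᵁ V by
    obtain ⟨U, V, hU, hV, hx, e⟩ := this
    obtain ⟨O, rfl, rfl⟩ := h.exists_opens U V e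
    exact ⟨O, hx, hU, hV⟩
  by_cases hx : x ∈ Set.range f
  · obtain ⟨z, rfl⟩ := hx
    exact f.exists_isAffineOpen_preimage_eq g z
  · obtain ⟨U, hU, hxU, hUf⟩ := exists_isAffineOpen_mem_and_subset (X := X) (x := x)
      (U := ⟨(Set.range f)ᶜ, f.isClosedEmbedding.isClosed_range.isOpen_compl⟩) hx
    refine ⟨U, ⊥, hU, isAffineOpen_bot Y, hxU, ?_⟩
    ext z
    exact ⟨fun hz ↦ hUf hz ⟨z, rfl⟩, False.elim⟩

theorem exists_isAffineOpen (p : P) : ∃ O : Opens P, p ∈ O ∧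
    IsAffineOpen ((Opens.map inl.base).obj O) ∧ IsAffineOpen ((Opens.map inr.base).obj O) := by
  obtain ⟨x, rfl⟩ | ⟨y, rfl⟩ := h.exists_rep p
  · exact h.exists_isAffineOpen_inl x
  · obtain ⟨O, hO, hU, hV⟩ := h.symm.exists_isAffineOpen_inl y
    exact ⟨O, hO, hV, hU⟩

/-- Gluing two schemes along a common closed subscheme gives a scheme. -/
noncomputable def toScheme : Scheme.{u} where
  toLocallyRingedSpace := P
  local_affine p := by
    obtain ⟨O, hp, hU, hV⟩ := h.exists_isAffineOpen p
    exact ⟨⟨O, hp⟩, _, ⟨@asIso _ _ _ _ _ (h.isIso_toΓSpec hU hV)⟩⟩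

theorem isAffineOpen_toScheme {O : Opens P} (hU : IsAffineOpen ((Opens.map inl.base).obj O))
    (hV : IsAffineOpen ((Opens.map inr.base).obj O)) : IsAffineOpen (X := h.toScheme) O :=
  ⟨@isIso_of_reflects_iso _ _ _ _ _ _ (Scheme.Opens.toScheme (X := h.toScheme) O).toSpecΓ
    Scheme.forgetToLocallyRingedSpace (h.isIso_toΓSpec hU hV) _⟩

theorem isClosedImmersion_inl :
    IsClosedImmersion (X := X) (Y := h.toScheme) (Scheme.Hom.mk inl) := by
  refine isClosedImmersion_of_forall_exists_isAffineOpen _ fun p ↦ ?_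
  obtain ⟨O, hO, hU, hV⟩ := h.exists_isAffineOpen p
  exact ⟨O, hO, h.isAffineOpen_toScheme hU hV, hU, h.exists_inl_app_eq hV⟩

end IsGluing

theorem isClosedImmersion_inl_of_isPushout {Z X Y W : Scheme.{u}} {f : Z ⟶ X} {g : Z ⟶ Y}
    {inl : X ⟶ W} {inr : Y ⟶ W} [IsClosedImmersion f] [IsClosedImmersion g]
    (h : IsPushout f g inl inr) : IsClosedImmersion inl := by
  have h₁ := IsPushout.of_hasPushout f.toLRSHom g.toLRSHom
  have h₂ := IsGluing.of_isPushout h₁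
  have h₃ : IsPushout f g (Scheme.Hom.mk (pushout.inl f.toLRSHom g.toLRSHom) : X ⟶ h₂.toScheme)
      (Scheme.Hom.mk (pushout.inr f.toLRSHom g.toLRSHom)) :=
    .of_map Scheme.forgetToLocallyRingedSpace
      (Scheme.forgetToLocallyRingedSpace.map_injective h₁.w) h₁
  have := h₂.isClosedImmersion_inl
  rw [← h₃.inl_isoIsPushout_hom _ _ h]
  exact IsClosedImmersion.comp _ _

end AlgebraicGeometry

/-- If `f : Z → X` and `g : Z → Y` are closed immersions of schemes and the square with legs
`f`, `g` and coprojections `X → W`, `Y → W` is a pushout square of schemes, then both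
coprojections are closed immersions. -/
theorem isClosedImmersion_of_isPushout {Z X Y W : Scheme.{u}} (f : Z ⟶ X) (g : Z ⟶ Y)
    (inl : X ⟶ W) (inr : Y ⟶ W) [IsClosedImmersion f] [IsClosedImmersion g]
    (h : IsPushout f g inl inr) : IsClosedImmersion inl ∧ IsClosedImmersion inr :=
  ⟨isClosedImmersion_inl_of_isPushout h, isClosedImmersion_inl_of_isPushout h.flip⟩
end

section
/- Let m : W → X, n : W → Y, i : X → Z, j : Y → Z be closed immersions of schemes forming a pullback (cartesian) square with i ∘ m = j ∘ n. Then the canonical morphism X ⊔_W Y → Z induced by i and j via the universal property of the pushout is a closed immersion. -/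
open AlgebraicGeometry CategoryTheory CategoryTheory.Limits

universe u

namespace AlgebraicGeometry

lemma IsAffineOpen.toSpecΓ_SpecMap_appLE_fromSpec {X Y : Scheme.{u}} (f : X ⟶ Y)
    {U : Y.Opens} {V : X.Opens} (hU : IsAffineOpen U) (e : V ≤ f ⁻¹ᵁ U) :
    V.toSpecΓ ≫ Spec.map (f.appLE U V e) ≫ hU.fromSpec = V.ι ≫ f := by
  rw [Scheme.Opens.toSpecΓ_SpecMap_appLE_assoc, IsAffineOpen.fromSpec, ← hU.isoSpec_hom,
    Iso.hom_inv_id_assoc, Scheme.Hom.resLE_comp_ι]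

/-- A surjective quasi-compact scheme-theoretically dominant morphism is an epimorphism. -/
lemma epi_of_isSchemeTheoreticallyDominant_of_surjective {P Z : Scheme.{u}} (p : P ⟶ Z)
    [Surjective p] [QuasiCompact p] [IsSchemeTheoreticallyDominant p] : Epi p := by
  refine ⟨fun {T} a b hab ↦ Scheme.hom_ext_of_forall _ _ fun z ↦ ?_⟩
  have hz : a z = b z := by
    obtain ⟨x, rfl⟩ := p.surjective z
    rw [← Scheme.Hom.comp_apply, ← Scheme.Hom.comp_apply, hab]
  obtain ⟨V, hV, hzV, -⟩ := exists_isAffineOpen_mem_and_subset (U := (⊤ : T.Opens))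
    (x := a z) trivial
  let U : Z.Opens := a ⁻¹ᵁ V ⊓ b ⁻¹ᵁ V
  refine ⟨U, ⟨hzV, show b z ∈ V from hz ▸ hzV⟩, ?_⟩
  have : a.appLE V U inf_le_left = b.appLE V U inf_le_right := by
    ext s
    apply p.app_injective U
    rw [← CommRingCat.comp_apply, ← CommRingCat.comp_apply, Scheme.Hom.app_eq_appLE,
      Scheme.Hom.appLE_comp_appLE, Scheme.Hom.appLE_comp_appLE]
    simp only [hab]
  rw [← IsAffineOpen.toSpecΓ_SpecMap_appLE_fromSpec a hV inf_le_left, this,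
    IsAffineOpen.toSpecΓ_SpecMap_appLE_fromSpec b hV inf_le_right]

/-- A ring homomorphism whose values lie in the range of an injective one factors through it. -/
lemma CommRingCat.exists_comp_eq_of_injective {A B C : CommRingCat.{u}} (g : A ⟶ C) (f : B ⟶ C)
    (hf : Function.Injective f) (h : ∀ a, ∃ b, f b = g a) : ∃ k : A ⟶ B, k ≫ f = g := by
  let e := RingEquiv.ofBijective f.hom.rangeRestrict
    ⟨fun _ _ hxy ↦ hf (congr_arg Subtype.val hxy), f.hom.rangeRestrict_surjective⟩
  refine ⟨CommRingCat.ofHom (e.symm.toRingHom.comp (g.hom.codRestrict f.hom.range h)), ?_⟩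
  ext a
  exact congr(($(e.apply_symm_apply ⟨g a, h a⟩)).1)

/-- In a pushout of surjections `A ⟶ B` and `A ⟶ C`, a pair of elements of `B` and `C` with the
same image comes from `A`. -/
lemma CommRingCat.exists_eq_of_isPushout_of_surjective {A B C D : CommRingCat.{u}}
    {f : A ⟶ B} {g : A ⟶ C} {h : B ⟶ D} {k : C ⟶ D} (H : IsPushout f g h k)
    (hf : Function.Surjective f) (hg : Function.Surjective g) (b : B) (c : C) (hbc : h b = k c) :
    ∃ a, f a = b ∧ g a = c := by
  let q : A →+* A ⧸ (RingHom.ker f.hom ⊔ RingHom.ker g.hom) := Ideal.Quotient.mk _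
  let qf := RingHom.liftOfSurjective f.hom hf ⟨q, fun x hx ↦
    Ideal.Quotient.eq_zero_iff_mem.mpr (le_sup_left (b := RingHom.ker g.hom) hx)⟩
  let qg := RingHom.liftOfSurjective g.hom hg ⟨q, fun x hx ↦
    Ideal.Quotient.eq_zero_iff_mem.mpr (le_sup_right (a := RingHom.ker f.hom) hx)⟩
  have hqf (x : A) : qf (f x) = q x := f.hom.liftOfRightInverse_comp_apply ..
  have hqg (x : A) : qg (g x) = q x := g.hom.liftOfRightInverse_comp_apply ..
  have w : f ≫ CommRingCat.ofHom qf = g ≫ CommRingCat.ofHom qg := by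
    ext x
    exact (hqf x).trans (hqg x).symm
  obtain ⟨b, rfl⟩ := hf b
  obtain ⟨c, rfl⟩ := hg c
  have key : q b = q c := by
    rw [← hqf, ← hqg]
    have h₁ := congr($(H.inl_desc (CommRingCat.ofHom qf) (CommRingCat.ofHom qg) w) (f b))
    have h₂ := congr($(H.inr_desc (CommRingCat.ofHom qf) (CommRingCat.ofHom qg) w) (g c))
    exact h₁.symm.trans (congr((H.desc (CommRingCat.ofHom qf) (CommRingCat.ofHom qg) w) $hbc)
      |>.trans h₂)
  obtain ⟨x, hx, y, hy, hxy⟩ := Submodule.mem_sup.mp (Ideal.Quotient.eq.mp key)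
  rw [RingHom.mem_ker] at hx hy
  refine ⟨b - x, by rw [map_sub, sub_eq_self]; exact hx, ?_⟩
  rw [show b - x = c + y by linear_combination -hxy, map_add, add_eq_left]
  exact hy

/-- Let `p : P ⟶ Z` be a surjective, closed, quasi-compact and scheme-theoretically dominant
morphism. A morphism `f : P ⟶ T` which is constant on the fibres of `p`, and which on affine opens
pulls functions back to functions coming from `Z`, factors through `p`. -/
lemma exists_comp_eq_of_isSchemeTheoreticallyDominant {P Z T : Scheme.{u}} (p : P ⟶ Z)
    [Surjective p] [QuasiCompact p] [IsSchemeTheoreticallyDominant p] (hp : IsClosedMap p)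
    (f : P ⟶ T) (hfib : ∀ x y, p x = p y → f x = f y)
    (hsec : ∀ (U : Z.Opens) (V : T.Opens) (e : p ⁻¹ᵁ U ≤ f ⁻¹ᵁ V), IsAffineOpen U →
      ∀ s, ∃ t, p.app U t = f.appLE V (p ⁻¹ᵁ U) e s) :
    ∃ g : Z ⟶ T, p ≫ g = f := by
  have hloc (z : Z) : ∃ (U : Z.Opens) (a : U.toScheme ⟶ T), z ∈ U ∧
      ∀ (S : Scheme.{u}) (s : S ⟶ P) (t : S ⟶ U), s ≫ p = t ≫ U.ι → t ≫ a = s ≫ f := by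
    obtain ⟨x, rfl⟩ := p.surjective z
    obtain ⟨V, hV, hxV, -⟩ := exists_isAffineOpen_mem_and_subset (U := (⊤ : T.Opens))
      (x := f x) trivial
    let U₀ : Z.Opens := ⟨(p '' (f ⁻¹ᵁ V : Set P)ᶜ)ᶜ,
      (hp _ (f ⁻¹ᵁ V).isOpen.isClosed_compl).isOpen_compl⟩
    have hxU₀ : p x ∈ U₀ := by
      rintro ⟨y, hy, hyx⟩
      exact hy (show f y ∈ V from hfib y x hyx ▸ hxV)
    obtain ⟨U, hU, hxU, hUU₀⟩ := exists_isAffineOpen_mem_and_subset hxU₀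
    have e : p ⁻¹ᵁ U ≤ f ⁻¹ᵁ V := fun y hy ↦ by
      by_contra hy'
      exact hUU₀ hy ⟨y, hy', rfl⟩
    obtain ⟨k, hk⟩ := CommRingCat.exists_comp_eq_of_injective (f.appLE V (p ⁻¹ᵁ U) e) (p.app U)
      (p.app_injective U) (hsec U V e hU)
    refine ⟨U, U.toSpecΓ ≫ Spec.map k ≫ hV.fromSpec, hxU, fun S s t hst ↦ ?_⟩
    let r := (isPullback_morphismRestrict p U).lift t s hst.symm
    have hr₁ : r ≫ (p ∣_ U) = t := (isPullback_morphismRestrict p U).lift_fst _ _ _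
    have hr₂ : r ≫ (p ⁻¹ᵁ U).ι = s := (isPullback_morphismRestrict p U).lift_snd _ _ _
    rw [← hr₁, ← hr₂, Category.assoc, Category.assoc,
      ← IsAffineOpen.toSpecΓ_SpecMap_appLE_fromSpec f hV e, ← hk, Spec.map_comp,
      Category.assoc, Scheme.Opens.toSpecΓ_naturality_assoc]
  choose U a hzU ha using hloc
  let 𝒰 : Z.OpenCover := Z.openCoverOfIsOpenCover U
    (TopologicalSpace.IsOpenCover.mk (eq_top_iff.mpr fun z _ ↦
      TopologicalSpace.Opens.mem_iSup.mpr ⟨z, hzU z⟩))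
  refine ⟨𝒰.glueMorphisms a fun x y ↦ ?_, ?_⟩
  · have : Epi (pullback.snd p (pullback.fst (𝒰.f x) (𝒰.f y) ≫ 𝒰.f x)) :=
      epi_of_isSchemeTheoreticallyDominant_of_surjective _
    rw [← cancel_epi (pullback.snd p (pullback.fst (𝒰.f x) (𝒰.f y) ≫ 𝒰.f x))]
    refine (Category.assoc _ _ _).symm.trans <| (ha x _ (pullback.fst _ _) _ ?_).trans <|
      (ha y _ (pullback.fst _ _) _ ?_).symm.trans (Category.assoc _ _ _)
    · exact pullback.condition.trans (Category.assoc _ _ _).symm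
    · exact pullback.condition.trans <| (congr(pullback.snd p
        (pullback.fst (𝒰.f x) (𝒰.f y) ≫ 𝒰.f x) ≫ $(pullback.condition))).trans
          (Category.assoc _ _ _).symm
  · refine Scheme.hom_ext_of_forall _ _ fun x ↦ ⟨p ⁻¹ᵁ U (p x), hzU _, ?_⟩
    rw [← morphismRestrict_ι_assoc]
    refine (congr((p ∣_ U (p x)) ≫ $(𝒰.ι_glueMorphisms a _ (p x)))).trans ?_
    exact ha _ _ _ _ (morphismRestrict_ι p _).symm

/-- Sections over an open of a binary coproduct of schemes are determined by their restrictions to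
the two summands. -/
lemma Scheme.coprod_section_ext {X Y : Scheme.{u}} {U : (X ⨿ Y).Opens} {s t : Γ(X ⨿ Y, U)}
    (hl : (coprod.inl : X ⟶ X ⨿ Y).app U s = (coprod.inl : X ⟶ X ⨿ Y).app U t)
    (hr : (coprod.inr : Y ⟶ X ⨿ Y).app U s = (coprod.inr : Y ⟶ X ⨿ Y).app U t) : s = t := by
  refine TopCat.Presheaf.section_ext (X ⨿ Y).sheaf U s t fun x hx ↦ ?_
  have aux {S : Scheme.{u}} (f : S ⟶ X ⨿ Y) [IsOpenImmersion f] (hf : f.app U s = f.app U t)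
      (y : S) (hy : f y ∈ U) :
      (X ⨿ Y).presheaf.germ U (f y) hy s = (X ⨿ Y).presheaf.germ U (f y) hy t := by
    apply (ConcreteCategory.bijective_of_isIso (f.stalkMap y)).injective
    rw [Scheme.Hom.germ_stalkMap_apply, Scheme.Hom.germ_stalkMap_apply, hf]
  have hx' : (∃ y, (coprod.inl : X ⟶ X ⨿ Y) y = x) ∨ ∃ y, (coprod.inr : Y ⟶ X ⨿ Y) y = x := by
    obtain ⟨y | y, rfl⟩ := (coprodMk X Y).surjective x
    · exact .inl ⟨y, (coprodMk_inl X Y y).symm⟩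
    · exact .inr ⟨y, (coprodMk_inr X Y y).symm⟩
  rcases hx' with ⟨y, rfl⟩ | ⟨y, rfl⟩
  · exact aux coprod.inl hl y hx
  · exact aux coprod.inr hr y hx

/-- Compare two sections over `p ⁻¹ᵁ U` after restriction along `k`. -/
lemma Scheme.Hom.app_app_eq_app_appLE {S P Z T : Scheme.{u}} {k : S ⟶ P} {p : P ⟶ Z} {F : P ⟶ T}
    {i : S ⟶ Z} {f : S ⟶ T} (hi : k ≫ p = i) (hf : k ≫ F = f) {U : Z.Opens} {V : T.Opens}
    (e : p ⁻¹ᵁ U ≤ F ⁻¹ᵁ V) (e' : i ⁻¹ᵁ U ≤ f ⁻¹ᵁ V) {s : Γ(T, V)} {t : Γ(Z, U)}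
    (h : i.app U t = f.appLE V (i ⁻¹ᵁ U) e' s) :
    k.app (p ⁻¹ᵁ U) (p.app U t) = k.app (p ⁻¹ᵁ U) (F.appLE V (p ⁻¹ᵁ U) e s) := by
  subst hi hf
  have hF : (k ≫ F).appLE V (k ⁻¹ᵁ p ⁻¹ᵁ U) e' =
      F.appLE V (p ⁻¹ᵁ U) e ≫ k.app (p ⁻¹ᵁ U) := by
    rw [Scheme.Hom.app_eq_appLE, Scheme.Hom.appLE_comp_appLE]
  rw [Scheme.Hom.comp_app] at h
  exact h.trans congr($hF s)

/-- A pullback square of closed immersions `i : X ⟶ Z` and `j : Y ⟶ Z` is a pushout square if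
`X ⨿ Y ⟶ Z` is scheme-theoretically dominant. -/
lemma isPushout_of_isPullback_of_isSchemeTheoreticallyDominant {W X Y Z : Scheme.{u}}
    {m : W ⟶ X} {n : W ⟶ Y} {i : X ⟶ Z} {j : Y ⟶ Z}
    [IsClosedImmersion i] [IsClosedImmersion j] (h : IsPullback m n i j)
    [IsSchemeTheoreticallyDominant (coprod.desc i j)] : IsPushout m n i j := by
  let p := coprod.desc i j
  have : IsFinite p := inferInstance
  have hp : IsClosedMap p := p.isClosedMap
  have : Surjective p := ⟨by
    rw [← Set.range_eq_univ, ← hp.isClosed_range.closure_eq]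
    exact p.denseRange.closure_eq⟩
  have : Epi p := epi_of_isSchemeTheoreticallyDominant_of_surjective _
  have hil : coprod.inl ≫ p = i := coprod.inl_desc _ _
  have hjr : coprod.inr ≫ p = j := coprod.inr_desc _ _
  have key {T : Scheme.{u}} (f : X ⟶ T) (g : Y ⟶ T) (w : m ≫ f = n ≫ g) :
      ∃ l : Z ⟶ T, p ≫ l = coprod.desc f g := by
    have hfib' (x : X) (y : Y) (hxy : i x = j y) : f x = g y := by
      obtain ⟨z, rfl, rfl⟩ := Scheme.exists_preimage_of_isPullback h x y hxy
      exact congr($w z)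
    refine exists_comp_eq_of_isSchemeTheoreticallyDominant p hp _ ?_ ?_
    · intro x y hxy
      obtain ⟨x | x, rfl⟩ := (coprodMk X Y).surjective x <;>
      obtain ⟨y | y, rfl⟩ := (coprodMk X Y).surjective y <;>
      simp only [coprodMk_inl, coprodMk_inr, ← Scheme.Hom.comp_apply, hil, hjr, coprod.inl_desc,
        coprod.inr_desc] at hxy ⊢
      · rw [i.isClosedEmbedding.injective hxy]
      · exact hfib' _ _ hxy
      · exact (hfib' _ _ hxy.symm).symm
      · rw [j.isClosedEmbedding.injective hxy]
    · intro U V e hU s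
      have el : i ⁻¹ᵁ U ≤ f ⁻¹ᵁ V := by
        conv_lhs => rw [← hil]
        conv_rhs => rw [← coprod.inl_desc f g]
        exact fun x hx ↦ e hx
      have er : j ⁻¹ᵁ U ≤ g ⁻¹ᵁ V := by
        conv_lhs => rw [← hjr]
        conv_rhs => rw [← coprod.inr_desc f g]
        exact fun x hx ↦ e hx
      have := isIso_pushoutSection_of_isAffineOpen h (US := U) (UT := j ⁻¹ᵁ U) (UX := i ⁻¹ᵁ U)
        le_rfl le_rfl rfl hU (hU.preimage j) (hU.preimage i)
      rw [isIso_pushoutSection_iff] at this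
      rw [← Scheme.Hom.app_eq_appLE, ← Scheme.Hom.app_eq_appLE] at this
      obtain ⟨t, ht₁, ht₂⟩ := CommRingCat.exists_eq_of_isPushout_of_surjective this
        (i.app_surjective U hU) (j.app_surjective U hU)
        (f.appLE V _ el s) (g.appLE V _ er s) (by
          rw [← CommRingCat.comp_apply, ← CommRingCat.comp_apply, Scheme.Hom.appLE_comp_appLE,
            Scheme.Hom.appLE_comp_appLE]
          simp only [w])
      refine ⟨t, Scheme.coprod_section_ext ?_ ?_⟩
      · exact Scheme.Hom.app_app_eq_app_appLE hil (coprod.inl_desc f g) e el ht₁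
      · exact Scheme.Hom.app_app_eq_app_appLE hjr (coprod.inr_desc f g) e er ht₂
  refine ⟨⟨h.w⟩, ⟨PushoutCocone.IsColimit.mk _ (fun s ↦ (key s.inl s.inr s.condition).choose)
    (fun s ↦ ?_) (fun s ↦ ?_) (fun s l hl hr ↦ ?_)⟩⟩
  · rw [← hil, Category.assoc, (key s.inl s.inr s.condition).choose_spec, coprod.inl_desc]
  · rw [← hjr, Category.assoc, (key s.inl s.inr s.condition).choose_spec, coprod.inr_desc]
  · rw [← cancel_epi p, (key s.inl s.inr s.condition).choose_spec]
    ext1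
    · rw [coprod.inl_desc, reassoc_of% hil, hl]
    · rw [coprod.inr_desc, reassoc_of% hjr, hr]

instance Scheme.Hom.isSchemeTheoreticallyDominant_toImage {X Y : Scheme.{u}} (f : X ⟶ Y)
    [QuasiCompact f] : IsSchemeTheoreticallyDominant f.toImage := by
  refine ⟨Scheme.IdealSheafData.ext (funext fun U ↦ ?_)⟩
  rw [Scheme.Hom.ker_apply, Scheme.IdealSheafData.ideal_bot]
  exact (RingHom.injective_iff_ker_eq_bot _).mp <|
    (TopCat.Presheaf.app_injective_iff_stalkFunctor_map_injective (F := f.image.sheaf)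
      f.toImage.c).mp (fun x ↦ f.stalkFunctor_toImage_injective x) U.1

end AlgebraicGeometry

/-- Let `m : W → X`, `n : W → Y`, `i : X → Z`, `j : Y → Z` be closed immersions of schemes
forming a pullback square (so `i ∘ m = j ∘ n`).  Then the pushout `X ⊔_W Y` exists and the
canonical morphism `X ⊔_W Y → Z` induced by `i` and `j` is a closed immersion. -/
theorem isClosedImmersion_pushoutDesc_of_isPullback {W X Y Z : Scheme.{u}}
    (m : W ⟶ X) (n : W ⟶ Y) (i : X ⟶ Z) (j : Y ⟶ Z)
    [IsClosedImmersion m] [IsClosedImmersion n] [IsClosedImmersion i] [IsClosedImmersion j]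
    (h : IsPullback m n i j) :
    ∃ hp : HasPushout m n,
      IsClosedImmersion (@pushout.desc Scheme.{u} _ Z W X Y m n hp i j h.w) := by
  let p := coprod.desc i j
  let i' : X ⟶ p.image := coprod.inl ≫ p.toImage
  let j' : Y ⟶ p.image := coprod.inr ≫ p.toImage
  have hi : i' ≫ p.imageι = i := by
    rw [Category.assoc, p.toImage_imageι, coprod.inl_desc]
  have hj : j' ≫ p.imageι = j := by
    rw [Category.assoc, p.toImage_imageι, coprod.inr_desc]
  have : IsClosedImmersion (i' ≫ p.imageι) := hi ▸ inferInstance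
  have : IsClosedImmersion (j' ≫ p.imageι) := hj ▸ inferInstance
  have : IsClosedImmersion i' := .of_comp_isClosedImmersion _ p.imageι
  have : IsClosedImmersion j' := .of_comp_isClosedImmersion _ p.imageι
  have hd : coprod.desc i' j' = p.toImage := by
    ext1
    · exact coprod.inl_desc _ _
    · exact coprod.inr_desc _ _
  have : IsSchemeTheoreticallyDominant (coprod.desc i' j') := by
    rw [hd]
    have : IsFinite p := inferInstance
    infer_instance
  have h' : IsPullback m n i' j' := by
    refine ⟨⟨?_⟩, ⟨PullbackCone.IsLimit.mk _
      (fun s ↦ h.lift s.fst s.snd ?_) (fun s ↦ h.lift_fst _ _ _) (fun s ↦ h.lift_snd _ _ _)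
      fun s l hl hr ↦ h.hom_ext ?_ ?_⟩⟩
    · rw [← cancel_mono p.imageι, Category.assoc m, Category.assoc n, hi, hj, h.w]
    · rw [← hi, ← hj, s.condition_assoc]
    · rw [h.lift_fst, hl]
    · rw [h.lift_snd, hr]
  have H := isPushout_of_isPullback_of_isSchemeTheoreticallyDominant h'
  refine ⟨H.hasPushout, ?_⟩
  have := H.hasPushout
  have hdesc : pushout.desc i j h.w = H.isoPushout.inv ≫ p.imageι := by
    ext1
    · rw [pushout.inl_desc, H.inl_isoPushout_inv_assoc, hi]
    · rw [pushout.inr_desc, H.inr_isoPushout_inv_assoc, hj]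
  rw [hdesc]
  infer_instance
end

section
/- Pushout squares along closed immersions of schemes are pullback squares: let f : Z → X and g : Z → Y be closed immersions of schemes, and suppose the square with legs f, g and coprojections X → W, Y → W is a pushout square in the category of schemes. Then this same square is also a pullback (cartesian) square. -/
open AlgebraicGeometry CategoryTheory CategoryTheory.Limits

universe u

section Ring

variable {A B C A' B' C' : Type*} [CommRing A] [CommRing B] [CommRing C]
  [CommRing A'] [CommRing B'] [CommRing C']

/-- The fibre product `A ×_C B` of commutative rings, as a subring of `A × B`. -/
def RingHom.fiberProduct (φ : A →+* C) (ψ : B →+* C) : Subring (A × B) :=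
  (φ.comp (RingHom.fst A B)).eqLocus (ψ.comp (RingHom.snd A B))

namespace RingHom.fiberProduct

/-- The first projection `A ×_C B → A`. -/
def fst (φ : A →+* C) (ψ : B →+* C) : φ.fiberProduct ψ →+* A :=
  (RingHom.fst A B).comp (Subring.subtype _)

/-- The second projection `A ×_C B → B`. -/
def snd (φ : A →+* C) (ψ : B →+* C) : φ.fiberProduct ψ →+* B :=
  (RingHom.snd A B).comp (Subring.subtype _)

variable {φ : A →+* C} {ψ : B →+* C} {φ' : A' →+* C'} {ψ' : B' →+* C'}

lemma condition (r : φ.fiberProduct ψ) : φ (fst φ ψ r) = ψ (snd φ ψ r) := r.2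

@[ext]
lemma ext {r s : φ.fiberProduct ψ} (h₁ : fst φ ψ r = fst φ ψ s) (h₂ : snd φ ψ r = snd φ ψ s) :
    r = s :=
  Subtype.ext (Prod.ext h₁ h₂)

/-- The map between fibre products induced by a map between cospans. -/
def map {α : A →+* A'} {β : B →+* B'} {γ : C →+* C'} (hα : φ'.comp α = γ.comp φ)
    (hβ : ψ'.comp β = γ.comp ψ) : φ.fiberProduct ψ →+* φ'.fiberProduct ψ' :=
  ((α.comp (fst φ ψ)).prod (β.comp (snd φ ψ))).codRestrict _ fun r ↦ by
    change φ'.comp α (fst φ ψ r) = ψ'.comp β (snd φ ψ r)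
    simp [hα, hβ, condition]

section

variable {α : A →+* A'} {β : B →+* B'} {γ : C →+* C'} (hα : φ'.comp α = γ.comp φ)
  (hβ : ψ'.comp β = γ.comp ψ)

@[simp]
lemma fst_map (r : φ.fiberProduct ψ) : fst φ' ψ' (map hα hβ r) = α (fst φ ψ r) := rfl

@[simp]
lemma snd_map (r : φ.fiberProduct ψ) : snd φ' ψ' (map hα hβ r) = β (snd φ ψ r) := rfl

lemma isLocalization_away_map (r : φ.fiberProduct ψ)
    (h₁ : @IsLocalization.Away _ _ (fst φ ψ r) A' _ α.toAlgebra)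
    (h₂ : @IsLocalization.Away _ _ (snd φ ψ r) B' _ β.toAlgebra)
    (h₃ : @IsLocalization.Away _ _ (φ (fst φ ψ r)) C' _ γ.toAlgebra) :
    @IsLocalization.Away _ _ r (φ'.fiberProduct ψ') _ (map hα hβ).toAlgebra := by
  let := α.toAlgebra
  let := β.toAlgebra
  let := γ.toAlgebra
  let := (map hα hβ).toAlgebra
  have hα' (x) : φ' (α x) = γ (φ x) := congr($hα x)
  have hβ' (x) : ψ' (β x) = γ (ψ x) := congr($hβ x)
  refine .mk _ ?_ ?_ ?_
  · obtain ⟨a, ha⟩ := isUnit_iff_exists_inv.mp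
      (IsLocalization.Away.algebraMap_isUnit (S := A') (fst φ ψ r))
    obtain ⟨b, hb⟩ := isUnit_iff_exists_inv.mp
      (IsLocalization.Away.algebraMap_isUnit (S := B') (snd φ ψ r))
    have hc := IsLocalization.Away.algebraMap_isUnit (S := C') (φ (fst φ ψ r))
    simp only [RingHom.algebraMap_toAlgebra] at ha hb hc ⊢
    refine isUnit_iff_exists_inv.mpr ⟨⟨(a, b), ?_⟩, ext ha hb⟩
    change φ' a = ψ' b
    rw [← hc.mul_right_inj, ← hα', ← map_mul, ha, hα', condition, ← hβ', ← map_mul, hb, map_one,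
      map_one]
  · intro s
    obtain ⟨n, a, ha⟩ := IsLocalization.Away.surj (fst φ ψ r) (fst φ' ψ' s)
    obtain ⟨m, b, hb⟩ := IsLocalization.Away.surj (snd φ ψ r) (snd φ' ψ' s)
    simp only [RingHom.algebraMap_toAlgebra] at ha hb ⊢
    have h : algebraMap C C' (φ (a * fst φ ψ r ^ m)) = algebraMap C C' (ψ (b * snd φ ψ r ^ n)) := by
      simp only [RingHom.algebraMap_toAlgebra]
      rw [← hα', ← hβ', map_mul α, map_mul β, ← ha, ← hb]
      simp only [map_mul, map_pow, condition s, hα', hβ', condition r]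
      ring
    obtain ⟨k, hk⟩ := IsLocalization.Away.exists_of_eq (φ (fst φ ψ r)) h
    refine ⟨n + m + k, ⟨(fst φ ψ r ^ k * (a * fst φ ψ r ^ m),
      snd φ ψ r ^ k * (b * snd φ ψ r ^ n)), ?_⟩, ?_⟩
    · change φ (fst φ ψ r ^ k * (a * fst φ ψ r ^ m)) = ψ (snd φ ψ r ^ k * (b * snd φ ψ r ^ n))
      rw [map_mul, map_pow, hk, map_mul ψ (_ ^ k), map_pow, condition]
    · ext
      · change _ = α (fst φ ψ r ^ k * (a * fst φ ψ r ^ m))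
        rw [map_mul α, map_mul α a, ← ha]
        simp only [map_mul, map_pow, fst_map]
        ring
      · change _ = β (snd φ ψ r ^ k * (b * snd φ ψ r ^ n))
        rw [map_mul β, map_mul β b, ← hb]
        simp only [map_mul, map_pow, snd_map]
        ring
  · intro s t hst
    obtain ⟨n, hn⟩ := IsLocalization.Away.exists_of_eq (S := A') (fst φ ψ r)
      (a := fst φ ψ s) (b := fst φ ψ t) congr(fst φ' ψ' $hst)
    obtain ⟨m, hm⟩ := IsLocalization.Away.exists_of_eq (S := B') (snd φ ψ r)
      (a := snd φ ψ s) (b := snd φ ψ t) congr(snd φ' ψ' $hst)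
    refine ⟨n + m, ext ?_ ?_⟩
    · simp only [map_mul, map_pow]
      linear_combination fst φ ψ r ^ m * hn
    · simp only [map_mul, map_pow]
      linear_combination snd φ ψ r ^ n * hm

end

end RingHom.fiberProduct

lemma CommRingCat.isPushout_fiberProduct_of_surjective {A B C : CommRingCat.{u}}
    (φ : A ⟶ C) (ψ : B ⟶ C) (hφ : Function.Surjective φ) :
    IsPushout (ofHom (RingHom.fiberProduct.fst φ.hom ψ.hom))
      (ofHom (RingHom.fiberProduct.snd φ.hom ψ.hom)) φ ψ := by
  have h₀ (s : PushoutCocone (ofHom (RingHom.fiberProduct.fst φ.hom ψ.hom))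
      (ofHom (RingHom.fiberProduct.snd φ.hom ψ.hom))) (r) :
      s.inl (RingHom.fiberProduct.fst φ.hom ψ.hom r) =
        s.inr (RingHom.fiberProduct.snd φ.hom ψ.hom r) := congr($(s.condition) r)
  have h₁ (s : PushoutCocone (ofHom (RingHom.fiberProduct.fst φ.hom ψ.hom))
      (ofHom (RingHom.fiberProduct.snd φ.hom ψ.hom))) :
      ∃ d : C ⟶ s.pt, ∀ a, d (φ a) = s.inl a := by
    refine ⟨ofHom (φ.hom.liftOfSurjective hφ ⟨s.inl.hom, fun a ha ↦ ?_⟩), fun a ↦ ?_⟩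
    · exact (h₀ s ⟨(a, 0), show φ.hom a = ψ.hom 0 by simpa using ha⟩).trans (map_zero s.inr.hom)
    · exact RingHom.liftOfRightInverse_comp_apply _ _ (Function.rightInverse_surjInv hφ) _ a
  choose d hd using h₁
  refine ⟨⟨?_⟩, ⟨PushoutCocone.IsColimit.mk _ d (fun s ↦ ?_) (fun s ↦ ?_) ?_⟩⟩
  · ext r
    exact RingHom.fiberProduct.condition r
  · ext a
    exact hd s a
  · ext b
    obtain ⟨a, ha⟩ := hφ (ψ b)
    change d s (ψ b) = _
    rw [← ha, hd]
    exact h₀ s ⟨(a, b), ha⟩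
  · intro s m hm _
    ext c
    obtain ⟨a, rfl⟩ := hφ c
    exact congr($hm a).trans (hd s a).symm

end Ring

namespace AlgebraicGeometry

/-- An affine chart for gluing `X` and `Y` along `Z`: affine opens of `X` and `Y` with the same
preimage in `Z`. -/
structure GluingChart {X Y Z : Scheme.{u}} (f : Z ⟶ X) (g : Z ⟶ Y) where
  /-- The affine open of `X`. -/
  U : X.Opens
  /-- The affine open of `Y`. -/
  V : Y.Opens
  /-- The common preimage in `Z`. -/
  O : Z.Opens
  isAffineOpen_U : IsAffineOpen U
  isAffineOpen_V : IsAffineOpen V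
  preimage_U : f ⁻¹ᵁ U = O
  preimage_V : g ⁻¹ᵁ V = O

namespace GluingChart

variable {X Y Z : Scheme.{u}} {f : Z ⟶ X} {g : Z ⟶ Y}

/-- The chart with the roles of `X` and `Y` exchanged. -/
def swap (k : GluingChart f g) : GluingChart g f where
  U := k.V
  V := k.U
  O := k.O
  isAffineOpen_U := k.isAffineOpen_V
  isAffineOpen_V := k.isAffineOpen_U
  preimage_U := k.preimage_V
  preimage_V := k.preimage_U

section

variable (k : GluingChart f g)

lemma isAffineOpen_O [IsAffineHom f] : IsAffineOpen k.O :=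
  k.preimage_U ▸ k.isAffineOpen_U.preimage f

/-- The pullback map `Γ(X, U) ⟶ Γ(Z, O)`. -/
noncomputable abbrev left : Γ(X, k.U) ⟶ Γ(Z, k.O) := f.appLE k.U k.O k.preimage_U.ge

/-- The pullback map `Γ(Y, V) ⟶ Γ(Z, O)`. -/
noncomputable abbrev right : Γ(Y, k.V) ⟶ Γ(Z, k.O) := g.appLE k.V k.O k.preimage_V.ge

lemma left_surjective [IsClosedImmersion f] : Function.Surjective k.left := by
  obtain ⟨U, V, O, hU, hV, rfl, h⟩ := k
  simpa only [left, Scheme.Hom.app_eq_appLE] using f.app_surjective U hU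

/-- The ring of pairs of functions on `U` and `V` which agree on `O`. -/
noncomputable abbrev ring : CommRingCat.{u} := .of (RingHom.fiberProduct k.left.hom k.right.hom)

/-- The projection from the chart ring to functions on `U`. -/
noncomputable abbrev fst : k.ring ⟶ Γ(X, k.U) :=
  CommRingCat.ofHom (RingHom.fiberProduct.fst k.left.hom k.right.hom)

/-- The projection from the chart ring to functions on `V`. -/
noncomputable abbrev snd : k.ring ⟶ Γ(Y, k.V) :=
  CommRingCat.ofHom (RingHom.fiberProduct.snd k.left.hom k.right.hom)

lemma condition (r : k.ring) : k.left (k.fst r) = k.right (k.snd r) :=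
  RingHom.fiberProduct.condition r

lemma basicOpen_left (a : Γ(X, k.U)) : Z.basicOpen (k.left a) = f ⁻¹ᵁ X.basicOpen a := by
  rw [Scheme.basicOpen_appLE, inf_eq_right, ← k.preimage_U]
  exact f.preimage_mono (X.basicOpen_le a)

lemma basicOpen_right (b : Γ(Y, k.V)) : Z.basicOpen (k.right b) = g ⁻¹ᵁ Y.basicOpen b := by
  rw [Scheme.basicOpen_appLE, inf_eq_right, ← k.preimage_V]
  exact g.preimage_mono (Y.basicOpen_le b)

/-- The basic open subchart defined by an element of the chart ring. -/
noncomputable def basicOpen (r : k.ring) : GluingChart f g where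
  U := X.basicOpen (k.fst r)
  V := Y.basicOpen (k.snd r)
  O := Z.basicOpen (k.left (k.fst r))
  isAffineOpen_U := k.isAffineOpen_U.basicOpen _
  isAffineOpen_V := k.isAffineOpen_V.basicOpen _
  preimage_U := (k.basicOpen_left _).symm
  preimage_V := by rw [condition, basicOpen_right]

end

section

variable {l k : GluingChart f g}

lemma O_le (hU : l.U ≤ k.U) : l.O ≤ k.O := by
  rw [← l.preimage_U, ← k.preimage_U]
  exact f.preimage_mono hU

lemma left_restrict (hU : l.U ≤ k.U) :
    l.left.hom.comp (X.presheaf.map (homOfLE hU).op).hom =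
      (Z.presheaf.map (homOfLE (O_le hU)).op).hom.comp k.left.hom := by
  simp only [← CommRingCat.hom_comp, Scheme.Hom.map_appLE, Scheme.Hom.appLE_map]

lemma right_restrict (hU : l.U ≤ k.U) (hV : l.V ≤ k.V) :
    l.right.hom.comp (Y.presheaf.map (homOfLE hV).op).hom =
      (Z.presheaf.map (homOfLE (O_le hU)).op).hom.comp k.right.hom := by
  simp only [← CommRingCat.hom_comp, Scheme.Hom.map_appLE, Scheme.Hom.appLE_map]

/-- The restriction map between chart rings. -/
noncomputable def res (hU : l.U ≤ k.U) (hV : l.V ≤ k.V) : k.ring ⟶ l.ring :=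
  CommRingCat.ofHom (RingHom.fiberProduct.map (left_restrict hU) (right_restrict hU hV))

lemma res_fst (hU : l.U ≤ k.U) (hV : l.V ≤ k.V) :
    res hU hV ≫ l.fst = k.fst ≫ X.presheaf.map (homOfLE hU).op := rfl

lemma res_snd (hU : l.U ≤ k.U) (hV : l.V ≤ k.V) :
    res hU hV ≫ l.snd = k.snd ≫ Y.presheaf.map (homOfLE hV).op := rfl

lemma basicOpen_fst_res (hU : l.U ≤ k.U) (hV : l.V ≤ k.V) (r : k.ring) :
    X.basicOpen (l.fst (res hU hV r)) = l.U ⊓ X.basicOpen (k.fst r) :=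
  Scheme.basicOpen_res _ _ _

lemma basicOpen_snd_res (hU : l.U ≤ k.U) (hV : l.V ≤ k.V) (r : k.ring) :
    Y.basicOpen (l.snd (res hU hV r)) = l.V ⊓ Y.basicOpen (k.snd r) :=
  Scheme.basicOpen_res _ _ _

lemma ring_hom_ext {R : CommRingCat.{u}} {a b : R ⟶ k.ring} (h₁ : a ≫ k.fst = b ≫ k.fst)
    (h₂ : a ≫ k.snd = b ≫ k.snd) : a = b := by
  refine CommRingCat.hom_ext (RingHom.ext fun r ↦ ?_)
  exact RingHom.fiberProduct.ext congr($h₁ r) congr($h₂ r)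

lemma isLocalization_res (hU : l.U ≤ k.U) (hV : l.V ≤ k.V) (r : k.ring)
    (hU' : l.U = X.basicOpen (k.fst r)) (hV' : l.V = Y.basicOpen (k.snd r)) [IsAffineHom f] :
    @IsLocalization.Away _ _ r l.ring _ (res hU hV).hom.toAlgebra :=
  RingHom.fiberProduct.isLocalization_away_map (left_restrict hU) (right_restrict hU hV) r
    (k.isAffineOpen_U.isLocalization_of_eq_basicOpen _ _ hU')
    (k.isAffineOpen_V.isLocalization_of_eq_basicOpen _ _ hV')
    (k.isAffineOpen_O.isLocalization_of_eq_basicOpen _ _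
      (by rw [← l.preimage_U, hU']; exact (k.basicOpen_left _).symm))

end

/-- A chart is smaller than another one if it is a basic open subchart of it. -/
instance [IsAffineHom f] : Preorder (GluingChart f g) where
  le l k := ∃ r : k.ring, l.U = X.basicOpen (k.fst r) ∧ l.V = Y.basicOpen (k.snd r)
  le_refl k := ⟨1, by rw [map_one, Scheme.basicOpen_one], by rw [map_one, Scheme.basicOpen_one]⟩
  le_trans l k j := by
    rintro ⟨s, hsU, hsV⟩ ⟨r, hrU, hrV⟩
    have hU : k.U ≤ j.U := hrU.trans_le (X.basicOpen_le _)
    have hV : k.V ≤ j.V := hrV.trans_le (Y.basicOpen_le _)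
    algebraize [(res hU hV).hom]
    have := isLocalization_res hU hV r hrU hrV
    obtain ⟨n, t, ht⟩ := IsLocalization.Away.surj r s
    have hr := IsLocalization.Away.algebraMap_isUnit (S := k.ring) r
    refine ⟨t * r, ?_, ?_⟩
    · have h := congr(X.basicOpen (k.fst $ht))
      rw [map_mul, Scheme.basicOpen_mul, ← hsU, Scheme.basicOpen_of_isUnit _ ((hr.pow n).map _),
        inf_eq_left.mpr (hsU.trans_le (X.basicOpen_le _))] at h
      rw [map_mul, Scheme.basicOpen_mul, ← hrU, inf_comm, h]
      exact basicOpen_fst_res hU hV t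
    · have h := congr(Y.basicOpen (k.snd $ht))
      rw [map_mul, Scheme.basicOpen_mul, ← hsV, Scheme.basicOpen_of_isUnit _ ((hr.pow n).map _),
        inf_eq_left.mpr (hsV.trans_le (Y.basicOpen_le _))] at h
      rw [map_mul, Scheme.basicOpen_mul, ← hrV, inf_comm, h]
      exact basicOpen_snd_res hU hV t

section

variable [IsAffineHom f] {l k j : GluingChart f g}

lemma U_mono (h : l ≤ k) : l.U ≤ k.U := by
  obtain ⟨r, hr, -⟩ := h
  exact hr.trans_le (X.basicOpen_le _)

lemma V_mono (h : l ≤ k) : l.V ≤ k.V := by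
  obtain ⟨r, -, hr⟩ := h
  exact hr.trans_le (Y.basicOpen_le _)

lemma basicOpen_le (k : GluingChart f g) (r : k.ring) : k.basicOpen r ≤ k := ⟨r, rfl, rfl⟩

/-- A basic open subchart of `k` is also a basic open subchart of any intermediate chart. -/
lemma le_of_le (h : l ≤ k) (hU : l.U ≤ j.U) (hV : l.V ≤ j.V) (hU' : j.U ≤ k.U)
    (hV' : j.V ≤ k.V) : l ≤ j := by
  obtain ⟨r, hrU, hrV⟩ := h
  refine ⟨res hU' hV' r, ?_, ?_⟩
  · rw [basicOpen_fst_res, ← hrU, inf_eq_right.mpr hU]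
  · rw [basicOpen_snd_res, ← hrV, inf_eq_right.mpr hV]

lemma isOpenImmersion_specMap_res (h : l ≤ k) :
    IsOpenImmersion (Spec.map (res (U_mono h) (V_mono h))) := by
  obtain ⟨r, hrU, hrV⟩ := id h
  algebraize [(res (U_mono h) (V_mono h)).hom]
  have := isLocalization_res (U_mono h) (V_mono h) r hrU hrV
  exact IsOpenImmersion.of_isLocalization r

lemma range_specMap_res (h : l ≤ k) (r : k.ring) (hrU : l.U = X.basicOpen (k.fst r))
    (hrV : l.V = Y.basicOpen (k.snd r)) :
    Set.range (Spec.map (res (U_mono h) (V_mono h))) =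
      (PrimeSpectrum.basicOpen r : Set (PrimeSpectrum k.ring)) := by
  algebraize [(res (U_mono h) (V_mono h)).hom]
  have := isLocalization_res (U_mono h) (V_mono h) r hrU hrV
  exact PrimeSpectrum.localization_away_comap_range l.ring r

variable (f g) in
/-- The diagram of affine schemes attached to the charts. -/
noncomputable def diagram : GluingChart f g ⥤ Scheme.{u} where
  obj k := Spec k.ring
  map h := Spec.map (res (U_mono h.le) (V_mono h.le))
  map_id k := by
    rw [← Spec.map_id]
    congr 1
    refine ring_hom_ext ?_ ?_
    · rw [res_fst, Category.id_comp]
      exact (congr(k.fst ≫ $(X.presheaf.map_id _))).trans (Category.comp_id _)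
    · rw [res_snd, Category.id_comp]
      exact (congr(k.snd ≫ $(Y.presheaf.map_id _))).trans (Category.comp_id _)
  map_comp a b := by
    rw [← Spec.map_comp]
    congr 1
    refine ring_hom_ext ?_ ?_
    · rw [Category.assoc, res_fst, res_fst, ← Category.assoc, res_fst, Category.assoc,
        ← Functor.map_comp]
      rfl
    · rw [Category.assoc, res_snd, res_snd, ← Category.assoc, res_snd, Category.assoc,
        ← Functor.map_comp]
      rfl

instance (h : l ⟶ k) : IsOpenImmersion ((diagram f g).map h) := isOpenImmersion_specMap_res h.le

instance : (diagram f g ⋙ Scheme.forget).IsLocallyDirected where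
  cond {i j k} fi fj xi xj h := by
    obtain ⟨r, hrU, hrV⟩ := fi.le
    obtain ⟨s, hsU, hsV⟩ := fj.le
    let l := k.basicOpen (r * s)
    have hlU : l.U = i.U ⊓ j.U := by
      rw [hrU, hsU, ← Scheme.basicOpen_mul, ← map_mul]; rfl
    have hlV : l.V = i.V ⊓ j.V := by
      rw [hrV, hsV, ← Scheme.basicOpen_mul, ← map_mul]; rfl
    have hlk : l ≤ k := k.basicOpen_le _
    have hli : l ≤ i := le_of_le hlk (hlU.trans_le inf_le_left) (hlV.trans_le inf_le_left)
      (U_mono fi.le) (V_mono fi.le)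
    have hlj : l ≤ j := le_of_le hlk (hlU.trans_le inf_le_right) (hlV.trans_le inf_le_right)
      (U_mono fj.le) (V_mono fj.le)
    have h' : (diagram f g).map fi xi = (diagram f g).map fj xj := h
    have hi : (diagram f g).map fi xi ∈ PrimeSpectrum.basicOpen r :=
      (range_specMap_res fi.le r hrU hrV).le ⟨xi, rfl⟩
    have hj : (diagram f g).map fi xi ∈ PrimeSpectrum.basicOpen s :=
      h' ▸ (range_specMap_res fj.le s hsU hsV).le ⟨xj, rfl⟩
    obtain ⟨x, hx⟩ : ∃ x, (diagram f g).map hlk.hom x = (diagram f g).map fi xi := by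
      refine (range_specMap_res hlk (r * s) rfl rfl).ge ?_
      rw [PrimeSpectrum.basicOpen_mul]
      exact ⟨hi, hj⟩
    refine ⟨l, hli.hom, hlj.hom, x, ?_, ?_⟩
    · apply ((diagram f g).map fi).isOpenEmbedding.injective
      rw [← hx, ← Subsingleton.elim (hli.hom ≫ fi) hlk.hom, Functor.map_comp]
      rfl
    · apply ((diagram f g).map fj).isOpenEmbedding.injective
      rw [← h', ← hx, ← Subsingleton.elim (hlj.hom ≫ fj) hlk.hom, Functor.map_comp]
      rfl

end

end GluingChart

/-- Morphisms on the members of an open cover glue if they agree locally on overlaps. -/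
lemma Scheme.exists_ι_comp_eq_of_locally_eq {X W : Scheme.{u}} {J : Type*} (U : J → X.Opens)
    (hU : ∀ x, ∃ i, x ∈ U i) (φ : ∀ i, (U i).toScheme ⟶ W)
    (H : ∀ i j x, x ∈ U i → x ∈ U j → ∃ (V : X.Opens) (hi : V ≤ U i) (hj : V ≤ U j),
      x ∈ V ∧ X.homOfLE hi ≫ φ i = X.homOfLE hj ≫ φ j) :
    ∃ F : X ⟶ W, ∀ i, (U i).ι ≫ F = φ i := by
  let 𝒰 := X.openCoverOfIsOpenCover U
    (.mk (top_le_iff.mp fun x _ ↦ TopologicalSpace.Opens.mem_iSup.mpr (hU x)))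
  suffices key : ∀ i j,
      pullback.fst (U i).ι (U j).ι ≫ φ i = pullback.snd (U i).ι (U j).ι ≫ φ j from
    ⟨𝒰.glueMorphisms φ key, 𝒰.ι_glueMorphisms φ key⟩
  intro i j
  refine Scheme.hom_ext_of_forall _ _ fun p ↦ ?_
  let a := pullback.fst (U i).ι (U j).ι
  let b := pullback.snd (U i).ι (U j).ι
  have hab : a ≫ (U i).ι = b ≫ (U j).ι := pullback.condition
  have hp : (U i).ι (a p) = (U j).ι (b p) := congr($hab p)
  obtain ⟨V, hi, hj, hx, h⟩ := H i j ((U i).ι (a p)) (a p).2 (hp ▸ (b p).2)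
  refine ⟨(a ≫ (U i).ι) ⁻¹ᵁ V, hx, ?_⟩
  let c := (a ≫ (U i).ι).resLE V _ le_rfl
  have hc : c ≫ V.ι = _ ≫ a ≫ (U i).ι := Scheme.Hom.resLE_comp_ι _ _
  have h₁ : c ≫ X.homOfLE hi = Scheme.Opens.ι _ ≫ a := by
    rw [← cancel_mono (U i).ι, Category.assoc, Scheme.homOfLE_ι, hc, Category.assoc]
  have h₂ : c ≫ X.homOfLE hj = Scheme.Opens.ι _ ≫ b := by
    rw [← cancel_mono (U j).ι, Category.assoc, Scheme.homOfLE_ι, hc, Category.assoc, hab]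
  rw [← Category.assoc, ← h₁, Category.assoc, h, ← Category.assoc, h₂, Category.assoc]

namespace GluingChart

variable {X Y Z : Scheme.{u}} {f : Z ⟶ X} {g : Z ⟶ Y}

lemma swap_le_swap [IsAffineHom f] [IsAffineHom g] {l k : GluingChart f g} (h : l ≤ k) :
    l.swap ≤ k.swap := by
  obtain ⟨r, hU, hV⟩ := h
  exact ⟨⟨(k.snd r, k.fst r), (k.condition r).symm⟩, hV, hU⟩

lemma exists_le_of_mem [IsClosedImmersion f] [IsClosedImmersion g] (k : GluingChart f g)
    {U : X.Opens} {V : Y.Opens} {x : X} (hx : x ∈ k.U) (hxU : x ∈ U)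
    (hxV : ∀ z, f z = x → g z ∈ V) :
    ∃ l ≤ k, x ∈ l.U ∧ l.U ≤ U ∧ l.V ≤ V := by
  have hclosed : IsClosed (f '' (g ⁻¹ᵁ V : Set Z)ᶜ) :=
    f.isClosedEmbedding.isClosedMap _ (g ⁻¹ᵁ V).isOpen.isClosed_compl
  let U' : X.Opens := U ⊓ ⟨_, hclosed.isOpen_compl⟩
  obtain ⟨a, haU, hxa⟩ := k.isAffineOpen_U.exists_basicOpen_le (V := U') ⟨x, by
    refine ⟨hxU, ?_⟩
    rintro ⟨z, hz, rfl⟩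
    exact hz (hxV z rfl)⟩ hx
  have haV : f ⁻¹ᵁ X.basicOpen a ≤ g ⁻¹ᵁ V := by
    intro z hz
    by_contra hz'
    exact (haU hz).2 ⟨z, hz', rfl⟩
  let J : Ideal Γ(Y, k.V) :=
    { carrier := {b | Y.basicOpen b ≤ V}
      zero_mem' := by simp
      add_mem' {b c} hb hc := (Y.basicOpen_add_le b c).trans (sup_le hb hc)
      smul_mem' b c hc := by
        rw [smul_eq_mul]
        exact (Y.basicOpen_mul b c).trans_le (inf_le_right.trans hc) }
  have hsurj : Function.Surjective k.right := k.swap.left_surjective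
  have hrad : k.left a ∈ (J.map k.right.hom).radical := by
    rw [Ideal.radical_eq_sInf, Ideal.mem_sInf]
    rintro P ⟨hJP, hP⟩
    by_contra haP
    let p : Spec Γ(Z, k.O) := ⟨P, hP⟩
    let z : Z := k.isAffineOpen_O.fromSpec p
    have hz (c : Γ(Z, k.O)) : z ∈ Z.basicOpen c ↔ c ∉ P := by
      change p ∈ k.isAffineOpen_O.fromSpec ⁻¹ᵁ Z.basicOpen c ↔ _
      rw [k.isAffineOpen_O.fromSpec_preimage_basicOpen]
      rfl
    have hza : z ∈ f ⁻¹ᵁ X.basicOpen a := k.basicOpen_left a ▸ (hz _).mpr haP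
    have hzk : g z ∈ k.V := by
      change z ∈ g ⁻¹ᵁ k.V
      rw [k.preimage_V, ← k.preimage_U]
      exact X.basicOpen_le a hza
    obtain ⟨b, hbV, hzb⟩ := k.isAffineOpen_V.exists_basicOpen_le (V := V) ⟨g z, haV hza⟩ hzk
    have hzb' : z ∈ Z.basicOpen (k.right b) := k.basicOpen_right b ▸ hzb
    exact (hz _).mp hzb' (hJP (Ideal.mem_map_of_mem _ hbV))
  obtain ⟨n, hn⟩ := hrad
  obtain ⟨b, hb, hab⟩ := (Ideal.mem_map_iff_of_surjective k.right.hom hsurj).mp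
    (Ideal.mul_mem_right (k.left a) _ hn)
  let r : k.ring := ⟨(a ^ (n + 1), b), by
    change k.left (a ^ (n + 1)) = k.right b
    rw [map_pow, pow_succ]
    exact hab.symm⟩
  have hr : (k.basicOpen r).U = X.basicOpen a := X.basicOpen_pow a n.succ_pos
  exact ⟨k.basicOpen r, k.basicOpen_le r, hr ▸ hxa, hr.trans_le (haU.trans inf_le_left), hb⟩

lemma exists_le_le [IsClosedImmersion f] [IsClosedImmersion g] (i j : GluingChart f g)
    {x : X} (hi : x ∈ i.U) (hj : x ∈ j.U) : ∃ l ≤ i, l ≤ j ∧ x ∈ l.U := by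
  have hO {k : GluingChart f g} (hk : x ∈ k.U) (z : Z) (hz : f z = x) : g z ∈ k.V := by
    subst hz
    change z ∈ g ⁻¹ᵁ k.V
    rw [k.preimage_V, ← k.preimage_U]
    exact hk
  obtain ⟨m, hmi, hxm, hmU, hmV⟩ := i.exists_le_of_mem hi hj (hO hj)
  obtain ⟨l, hlj, hxl, hlU, hlV⟩ := j.exists_le_of_mem hj hxm (hO hxm)
  exact ⟨l, (le_of_le hlj hlU hlV hmU hmV).trans hmi, hlj, hxl⟩

variable (f g) in
lemma exists_mem [IsClosedImmersion f] [IsClosedImmersion g] (x : X) :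
    ∃ k : GluingChart f g, x ∈ k.U := by
  by_cases hx : x ∈ Set.range f
  · obtain ⟨z, rfl⟩ := hx
    obtain ⟨_, ⟨U, hU, rfl⟩, hzU, -⟩ :=
      X.isBasis_affineOpens.exists_subset_of_mem_open (Set.mem_univ (f z)) isOpen_univ
    obtain ⟨_, ⟨V, hV, rfl⟩, hzV, -⟩ :=
      Y.isBasis_affineOpens.exists_subset_of_mem_open (Set.mem_univ (g z)) isOpen_univ
    obtain ⟨c, d, hcd, hz⟩ := exists_basicOpen_le_affine_inter (hU.preimage f) (hV.preimage g) z
      ⟨hzU, hzV⟩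
    obtain ⟨a, rfl⟩ := f.app_surjective U hU c
    obtain ⟨b, rfl⟩ := g.app_surjective V hV d
    rw [← Scheme.preimage_basicOpen] at hz
    exact ⟨⟨X.basicOpen a, Y.basicOpen b, _, hU.basicOpen a, hV.basicOpen b, rfl, by
      rw [Scheme.preimage_basicOpen, Scheme.preimage_basicOpen, hcd]⟩, hz⟩
  · obtain ⟨_, ⟨U, hU, rfl⟩, hxU, hU'⟩ := X.isBasis_affineOpens.exists_subset_of_mem_open
      (show x ∈ (Set.range f)ᶜ from hx) f.isClosedEmbedding.isClosed_range.isOpen_compl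
    refine ⟨⟨U, ⊥, ⊥, hU, isAffineOpen_bot Y, ?_, rfl⟩, hxU⟩
    exact eq_bot_iff.mpr fun z hz ↦ hU' hz ⟨z, rfl⟩

/-- The map from `U` to the spectrum of the chart ring. -/
noncomputable def toSpecLeft (k : GluingChart f g) : k.U.toScheme ⟶ Spec k.ring :=
  k.U.toSpecΓ ≫ Spec.map k.fst

/-- The map from `V` to the spectrum of the chart ring. -/
noncomputable def toSpecRight (k : GluingChart f g) : k.V.toScheme ⟶ Spec k.ring :=
  k.V.toSpecΓ ≫ Spec.map k.snd

section

variable [IsAffineHom f] {l k : GluingChart f g}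

variable (f g) in
/-- The scheme glued from the spectra of the chart rings. -/
noncomputable def glued : Scheme.{u} := colimit (diagram f g)

/-- The inclusion of the spectrum of a chart ring in the glued scheme. -/
noncomputable def ι (k : GluingChart f g) : Spec k.ring ⟶ glued f g := colimit.ι (diagram f g) k

instance : IsOpenImmersion k.ι := inferInstanceAs (IsOpenImmersion (colimit.ι (diagram f g) k))

lemma specMap_res_ι (h : l ≤ k) : Spec.map (res (U_mono h) (V_mono h)) ≫ k.ι = l.ι :=
  colimit.w (diagram f g) h.hom

lemma homOfLE_toSpecLeft (h : l ≤ k) :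
    X.homOfLE (U_mono h) ≫ k.toSpecLeft =
      l.toSpecLeft ≫ Spec.map (res (U_mono h) (V_mono h)) := by
  rw [toSpecLeft, toSpecLeft, Category.assoc, ← Spec.map_comp, res_fst, Spec.map_comp,
    Scheme.Opens.toSpecΓ_SpecMap_presheaf_map_assoc]

lemma homOfLE_toSpecLeft_ι (h : l ≤ k) :
    X.homOfLE (U_mono h) ≫ k.toSpecLeft ≫ k.ι = l.toSpecLeft ≫ l.ι := by
  rw [← Category.assoc, homOfLE_toSpecLeft h, Category.assoc, specMap_res_ι h]

lemma homOfLE_toSpecRight (h : l ≤ k) :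
    Y.homOfLE (V_mono h) ≫ k.toSpecRight =
      l.toSpecRight ≫ Spec.map (res (U_mono h) (V_mono h)) := by
  rw [toSpecRight, toSpecRight, Category.assoc, ← Spec.map_comp, res_snd, Spec.map_comp,
    Scheme.Opens.toSpecΓ_SpecMap_presheaf_map_assoc]

lemma homOfLE_toSpecRight_ι (h : l ≤ k) :
    Y.homOfLE (V_mono h) ≫ k.toSpecRight ≫ k.ι = l.toSpecRight ≫ l.ι := by
  rw [← Category.assoc, homOfLE_toSpecRight h, Category.assoc, specMap_res_ι h]

lemma mem_of_toSpecLeft_eq (h : l ⟶ k) {x : k.U.toScheme} {p : Spec l.ring}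
    (hp : (diagram f g).map h p = k.toSpecLeft x) : k.U.ι x ∈ l.U := by
  obtain ⟨r, hU, hV⟩ := h.le
  have hx : k.toSpecLeft x ∈ PrimeSpectrum.basicOpen r :=
    hp ▸ (range_specMap_res h.le r hU hV).le ⟨p, rfl⟩
  have hx' : x ∈ k.U.toSpecΓ ⁻¹ᵁ PrimeSpectrum.basicOpen (k.fst r) := hx
  rw [Scheme.Opens.toSpecΓ_preimage_basicOpen, ← hU] at hx'
  exact hx'

lemma mem_of_toSpecRight_eq (h : l ⟶ k) {y : k.V.toScheme} {p : Spec l.ring}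
    (hp : (diagram f g).map h p = k.toSpecRight y) : k.V.ι y ∈ l.V := by
  obtain ⟨r, hU, hV⟩ := h.le
  have hy : k.toSpecRight y ∈ PrimeSpectrum.basicOpen r :=
    hp ▸ (range_specMap_res h.le r hU hV).le ⟨p, rfl⟩
  have hy' : y ∈ k.V.toSpecΓ ⁻¹ᵁ PrimeSpectrum.basicOpen (k.snd r) := hy
  rw [Scheme.Opens.toSpecΓ_preimage_basicOpen, ← hV] at hy'
  exact hy'

end

lemma resLE_toSpecLeft (k : GluingChart f g) :
    f.resLE k.U k.O k.preimage_U.ge ≫ k.toSpecLeft =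
      g.resLE k.V k.O k.preimage_V.ge ≫ k.toSpecRight := by
  rw [toSpecLeft, toSpecRight, ← Scheme.Opens.toSpecΓ_SpecMap_appLE_assoc,
    ← Scheme.Opens.toSpecΓ_SpecMap_appLE_assoc, ← Spec.map_comp, ← Spec.map_comp]
  congr 2
  ext r
  exact k.condition r

lemma exists_lift [IsClosedImmersion f] (k : GluingChart f g) {T : Scheme.{u}}
    (a : T ⟶ k.U) (b : T ⟶ k.V) (h : a ≫ k.toSpecLeft = b ≫ k.toSpecRight) :
    ∃ c : T ⟶ Z, c ≫ f = a ≫ k.U.ι ∧ c ≫ g = b ≫ k.V.ι := by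
  have hpb := isPullback_SpecMap_of_isPushout _ _ _ _
    (CommRingCat.isPushout_fiberProduct_of_surjective k.left k.right k.left_surjective)
  refine ⟨hpb.lift (a ≫ k.U.toSpecΓ) (b ≫ k.V.toSpecΓ) (by simpa [toSpecLeft, toSpecRight] using h)
    ≫ k.isAffineOpen_O.fromSpec, ?_, ?_⟩
  · rw [Category.assoc, ← k.isAffineOpen_U.SpecMap_appLE_fromSpec f k.isAffineOpen_O
      k.preimage_U.ge, hpb.lift_fst_assoc, Category.assoc, k.isAffineOpen_U.toSpecΓ_fromSpec]
  · rw [Category.assoc, ← k.isAffineOpen_V.SpecMap_appLE_fromSpec g k.isAffineOpen_O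
      k.preimage_V.ge, hpb.lift_snd_assoc, Category.assoc, k.isAffineOpen_V.toSpecΓ_fromSpec]

variable [IsClosedImmersion f] [IsClosedImmersion g]

variable (f g) in
lemma exists_inl : ∃ iX : X ⟶ glued f g,
    ∀ k : GluingChart f g, k.U.ι ≫ iX = k.toSpecLeft ≫ k.ι := by
  refine Scheme.exists_ι_comp_eq_of_locally_eq _ (exists_mem f g) _ fun i j x hi hj ↦ ?_
  obtain ⟨l, hli, hlj, hx⟩ := i.exists_le_le j hi hj
  refine ⟨l.U, U_mono hli, U_mono hlj, hx, ?_⟩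
  rw [homOfLE_toSpecLeft_ι hli, homOfLE_toSpecLeft_ι hlj]

variable (f g) in
lemma exists_inr : ∃ iY : Y ⟶ glued f g,
    ∀ k : GluingChart f g, k.V.ι ≫ iY = k.toSpecRight ≫ k.ι := by
  refine Scheme.exists_ι_comp_eq_of_locally_eq _ (fun y ↦ ?_) _ fun i j y hi hj ↦ ?_
  · obtain ⟨k, hk⟩ := exists_mem g f y
    exact ⟨k.swap, hk⟩
  · obtain ⟨l, hli, hlj, hy⟩ := i.swap.exists_le_le j.swap hi hj
    have hli' : l.swap ≤ i := swap_le_swap hli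
    have hlj' : l.swap ≤ j := swap_le_swap hlj
    refine ⟨l.swap.V, V_mono hli', V_mono hlj', hy, ?_⟩
    rw [homOfLE_toSpecRight_ι hli', homOfLE_toSpecRight_ι hlj']

/-- Points of `X` and `Y` with the same image in the glued scheme lie in a common chart. -/
lemma exists_mem_mem_of_eq {inl : X ⟶ glued f g} {inr : Y ⟶ glued f g}
    (hinl : ∀ k : GluingChart f g, k.U.ι ≫ inl = k.toSpecLeft ≫ k.ι)
    (hinr : ∀ k : GluingChart f g, k.V.ι ≫ inr = k.toSpecRight ≫ k.ι)
    {x : X} {y : Y} (h : inl x = inr y) : ∃ k : GluingChart f g, x ∈ k.U ∧ y ∈ k.V := by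
  obtain ⟨i, hi⟩ := exists_mem f g x
  obtain ⟨j, hj⟩ := exists_mem g f y
  have h' : i.ι (i.toSpecLeft ⟨x, hi⟩) = j.swap.ι (j.swap.toSpecRight ⟨y, hj⟩) :=
    (congr($(hinl i) ⟨x, hi⟩).symm.trans h).trans congr($(hinr j.swap) ⟨y, hj⟩)
  obtain ⟨l, hli, hlj, p, hp, hq⟩ :=
    (Scheme.IsLocallyDirected.ι_eq_ι_iff (diagram f g) (i := i) (j := j.swap)).mp h'
  exact ⟨l, mem_of_toSpecLeft_eq hli hp, mem_of_toSpecRight_eq hlj hq⟩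

end GluingChart

open GluingChart in
/-- Two closed immersions with the same source fit into a pullback square. -/
lemma IsClosedImmersion.exists_isPullback {X Y Z : Scheme.{u}} (f : Z ⟶ X) (g : Z ⟶ Y)
    [IsClosedImmersion f] [IsClosedImmersion g] :
    ∃ (W : Scheme.{u}) (inl : X ⟶ W) (inr : Y ⟶ W), IsPullback f g inl inr := by
  obtain ⟨inl, hinl⟩ := exists_inl f g
  obtain ⟨inr, hinr⟩ := exists_inr f g
  have hw : f ≫ inl = g ≫ inr := by
    refine Scheme.hom_ext_of_forall _ _ fun z ↦ ?_
    obtain ⟨k, hk⟩ := exists_mem f g (f z)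
    refine ⟨k.O, k.preimage_U.le hk, ?_⟩
    rw [← Scheme.Hom.resLE_comp_ι_assoc f k.preimage_U.ge, hinl,
      ← Scheme.Hom.resLE_comp_ι_assoc g k.preimage_V.ge, hinr, ← Category.assoc,
      resLE_toSpecLeft, Category.assoc]
  have hlift {T : Scheme.{u}} (t : T ⟶ X) (s : T ⟶ Y) (hts : t ≫ inl = s ≫ inr) :
      ∃ c : T ⟶ Z, c ≫ f = t ∧ c ≫ g = s := by
    have hloc (p : T) : ∃ (S : T.Opens) (c : S.toScheme ⟶ Z),
        p ∈ S ∧ c ≫ f = S.ι ≫ t ∧ c ≫ g = S.ι ≫ s := by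
      obtain ⟨k, hU, hV⟩ := exists_mem_mem_of_eq hinl hinr (x := t p) (y := s p) congr($hts p)
      let S := t ⁻¹ᵁ k.U ⊓ s ⁻¹ᵁ k.V
      obtain ⟨c, hcf, hcg⟩ := k.exists_lift (t.resLE k.U S inf_le_left)
        (s.resLE k.V S inf_le_right) (by
          rw [← cancel_mono k.ι, Category.assoc, Category.assoc, ← hinl, ← hinr,
            Scheme.Hom.resLE_comp_ι_assoc, Scheme.Hom.resLE_comp_ι_assoc, hts])
      exact ⟨S, c, ⟨hU, hV⟩, hcf.trans (Scheme.Hom.resLE_comp_ι _ _),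
        hcg.trans (Scheme.Hom.resLE_comp_ι _ _)⟩
    choose S c hS hcf hcg using hloc
    obtain ⟨d, hd⟩ := Scheme.exists_ι_comp_eq_of_locally_eq S (fun p ↦ ⟨p, hS p⟩) c
      fun i j x hi hj ↦ ⟨S i ⊓ S j, inf_le_left, inf_le_right, ⟨hi, hj⟩, by
        rw [← cancel_mono f, Category.assoc, Category.assoc, hcf, hcf, Scheme.homOfLE_ι_assoc,
          Scheme.homOfLE_ι_assoc]⟩
    refine ⟨d, ?_, ?_⟩
    · exact Scheme.hom_ext_of_forall _ _ fun p ↦ ⟨S p, hS p, by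
        rw [← Category.assoc, hd, hcf]⟩
    · exact Scheme.hom_ext_of_forall _ _ fun p ↦ ⟨S p, hS p, by
        rw [← Category.assoc, hd, hcg]⟩
  choose c hcf hcg using fun s : PullbackCone inl inr ↦ hlift s.fst s.snd s.condition
  exact ⟨_, inl, inr, ⟨hw⟩, ⟨PullbackCone.IsLimit.mk hw c hcf hcg fun s m hm _ ↦ by
    rw [← cancel_mono f, hm, hcf]⟩⟩

end AlgebraicGeometry

/-- Pushout squares along closed immersions of schemes are pullback squares: if `f : Z → X`
and `g : Z → Y` are closed immersions and the square with legs `f`, `g` and coprojections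
`X → W`, `Y → W` is a pushout square of schemes, then it is also a pullback square. -/
theorem isPullback_of_isPushout_of_isClosedImmersion {Z X Y W : Scheme.{u}}
    (f : Z ⟶ X) (g : Z ⟶ Y) (inl : X ⟶ W) (inr : Y ⟶ W)
    [IsClosedImmersion f] [IsClosedImmersion g]
    (h : IsPushout f g inl inr) : IsPullback f g inl inr := by
  obtain ⟨W', inl', inr', h'⟩ := IsClosedImmersion.exists_isPullback f g
  have hs (s : PullbackCone inl inr) : s.fst ≫ inl' = s.snd ≫ inr' := by
    rw [← h.inl_desc inl' inr' h'.w, ← Category.assoc, s.condition, Category.assoc, h.inr_desc]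
  exact ⟨⟨h.w⟩, ⟨PullbackCone.IsLimit.mk h.w (fun s ↦ h'.lift s.fst s.snd (hs s))
    (fun s ↦ h'.lift_fst _ _ _) (fun s ↦ h'.lift_snd _ _ _)
    fun s m h₁ h₂ ↦ h'.hom_ext (by rw [h₁, h'.lift_fst]) (by rw [h₂, h'.lift_snd])⟩⟩
end
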